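/- arXiv:1112.2420 — 2 statements merged into one kernel-verified Lean document; each statement's English description precedes it below -/
import Mathlib

section
/- Let P : ℝ² → Matrix (Fin N) (Fin N) ℂ be a smooth rank-one Hermitian projector (P² = P, Pᴴ = P, tr P = 1 everywhere) satisfying the Euler–Lagrange equation [∂₊∂₋P, P] = 0. Then there exists a smooth map F : ℝ² → Matrix (Fin N) (Fin N) ℂ such that ∂₊F = −i[∂₊P, P] and ∂₋F = i[∂₋P, P] at every point, and F can be chosen so that F(z)ᴴ = −F(z) for all z ∈ ℝ² (i.e. F takes values in the skew-Hermitian matrices). -/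
open Matrix

noncomputable section

attribute [local instance] Matrix.normedAddCommGroup Matrix.normedSpace

/-- The Wirtinger derivative `∂₊ = ½(∂/∂x − i ∂/∂y)` of a matrix-valued map on `ℝ²`. -/
def dp {N : ℕ} (P : ℝ × ℝ → Matrix (Fin N) (Fin N) ℂ) (p : ℝ × ℝ) :
    Matrix (Fin N) (Fin N) ℂ :=
  (2 : ℂ)⁻¹ • (fderiv ℝ P p (1, 0) - Complex.I • fderiv ℝ P p (0, 1))

/-- The Wirtinger derivative `∂₋ = ½(∂/∂x + i ∂/∂y)` of a matrix-valued map on `ℝ²`. -/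
def dm {N : ℕ} (P : ℝ × ℝ → Matrix (Fin N) (Fin N) ℂ) (p : ℝ × ℝ) :
    Matrix (Fin N) (Fin N) ℂ :=
  (2 : ℂ)⁻¹ • (fderiv ℝ P p (1, 0) + Complex.I • fderiv ℝ P p (0, 1))


theorem closed_aux {E : Type*} [NormedAddCommGroup E] [NormedSpace ℝ E] [CompleteSpace E]
    (B : E →L[ℝ] E →L[ℝ] E) (hB : ∀ a, B a a = 0) (P : ℝ × ℝ → E)
    (hP : ContDiff ℝ (⊤ : ℕ∞) P)
    (h : ∀ p, B (fderiv ℝ (fderiv ℝ P) p (1, 0) (1, 0) +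
      fderiv ℝ (fderiv ℝ P) p (0, 1) (0, 1)) (P p) = 0) :
    ∃ F : ℝ × ℝ → E, ContDiff ℝ (⊤ : ℕ∞) F ∧
      (∀ p, fderiv ℝ F p (1, 0) = -B (fderiv ℝ P p (0, 1)) (P p)) ∧
      (∀ p, fderiv ℝ F p (0, 1) = B (fderiv ℝ P p (1, 0)) (P p)) := by
  have hP1 : ContDiff ℝ (⊤ : ℕ∞) (fderiv ℝ P) := hP.fderiv_right (by simp)
  have hg : ∀ v : ℝ × ℝ, ContDiff ℝ (⊤ : ℕ∞) (fun p => B (fderiv ℝ P p v) (P p)) := by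
    intro v
    fun_prop
  have hgd : ∀ v p w, fderiv ℝ (fun p => B (fderiv ℝ P p v) (P p)) p w =
      B (fderiv ℝ (fderiv ℝ P) p w v) (P p) + B (fderiv ℝ P p v) (fderiv ℝ P p w) := by
    intro v p w
    have h1 : HasFDerivAt P (fderiv ℝ P p) p :=
      (hP.differentiable (by simp) p).hasFDerivAt
    have h2 : HasFDerivAt (fderiv ℝ P) (fderiv ℝ (fderiv ℝ P) p) p :=
      (hP1.differentiable (by simp) p).hasFDerivAt
    have h3 := (h2.clm_apply (hasFDerivAt_const v p))
    have h4 := (B.hasFDerivAt.comp p h3).clm_apply h1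
    have h5 := h4.fderiv
    simp only [Function.comp_def] at h5
    rw [h5]
    simp
    try abel
  let ω : ℝ × ℝ → (ℝ × ℝ →L[ℝ] E) := fun p =>
    (ContinuousLinearMap.fst ℝ ℝ ℝ).smulRight (-B (fderiv ℝ P p (0, 1)) (P p)) +
    (ContinuousLinearMap.snd ℝ ℝ ℝ).smulRight (B (fderiv ℝ P p (1, 0)) (P p))
  have hω : ContDiff ℝ (⊤ : ℕ∞) ω :=
    (contDiff_const.smulRight (hg (0, 1)).neg).add (contDiff_const.smulRight (hg (1, 0)))
  have hωd : ∀ p v w, fderiv ℝ ω p v w =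
      w.1 • -fderiv ℝ (fun p => B (fderiv ℝ P p (0, 1)) (P p)) p v +
      w.2 • fderiv ℝ (fun p => B (fderiv ℝ P p (1, 0)) (P p)) p v := by
    intro p v w
    have a1 := ((hω.differentiable (by simp) p).hasFDerivAt.clm_apply
      (hasFDerivAt_const w p)).fderiv
    have g1 := ((hg (0, 1)).differentiable (by simp) p).hasFDerivAt
    have g2 := ((hg (1, 0)).differentiable (by simp) p).hasFDerivAt
    have a2 := ((g1.neg.const_smul w.1).add (g2.const_smul w.2)).fderiv
    have a3 := congrArg (fun L => L v) (a1.symm.trans a2)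
    simpa using a3
  obtain ⟨F, hF⟩ := convex_univ.exists_forall_hasFDerivAt_of_fderiv_symmetric (𝕜 := ℝ) isOpen_univ
    (hω.differentiable (by simp)).differentiableOn (by
      intro p _ v w
      have e : ∀ v : ℝ × ℝ, v = v.1 • ((1 : ℝ), (0 : ℝ)) + v.2 • ((0 : ℝ), (1 : ℝ)) := by
        intro v; ext <;> simp
      have key : fderiv ℝ ω p (1, 0) (0, 1) = fderiv ℝ ω p (0, 1) (1, 0) := by
        simp only [hωd, hgd]
        have := h p
        rw [map_add, _root_.add_apply] at this
        simp [hB]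
        exact eq_neg_of_add_eq_zero_left this
      rw [e v, e w]
      simp only [map_add, map_smul, _root_.add_apply, _root_.smul_apply,
        key, smul_add]
      simp only [smul_smul, mul_comm]
      abel)
  have hF' : fderiv ℝ F = ω := funext fun p => (hF p trivial).fderiv
  refine ⟨F, ?_, ?_, ?_⟩
  · rw [contDiff_infty_iff_fderiv]
    exact ⟨fun p => (hF p trivial).differentiableAt, hF' ▸ hω⟩
  · intro p; rw [hF']; simp [ω]
  · intro p; rw [hF']; simp [ω]

/-- abstract `∂₊` -/
def dpg {E : Type*} [NormedAddCommGroup E] [NormedSpace ℝ E] [NormedSpace ℂ E]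
    (P : ℝ × ℝ → E) (p : ℝ × ℝ) : E :=
  (2 : ℂ)⁻¹ • (fderiv ℝ P p (1, 0) - Complex.I • fderiv ℝ P p (0, 1))

/-- abstract `∂₋` -/
def dmg {E : Type*} [NormedAddCommGroup E] [NormedSpace ℝ E] [NormedSpace ℂ E]
    (P : ℝ × ℝ → E) (p : ℝ × ℝ) : E :=
  (2 : ℂ)⁻¹ • (fderiv ℝ P p (1, 0) + Complex.I • fderiv ℝ P p (0, 1))

theorem abstract_immersion {E : Type*} [NormedAddCommGroup E] [NormedSpace ℝ E] [NormedSpace ℂ E]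
    [IsScalarTower ℝ ℂ E] [FiniteDimensional ℝ E]
    (b : E → E → E) (hb1 : ∀ x x' y, b (x + x') y = b x y + b x' y)
    (hb2 : ∀ (c : ℂ) x y, b (c • x) y = c • b x y)
    (hb3 : ∀ x y y', b x (y + y') = b x y + b x y')
    (hb4 : ∀ (c : ℂ) x y, b x (c • y) = c • b x y)
    (hb : ∀ x, b x x = 0)
    (s : E → E) (hs1 : ∀ x y, s (x + y) = s x + s y) (hs2 : ∀ (c : ℝ) x, s (c • x) = c • s x)
    (hss : ∀ x, s (s x) = x) (hsb : ∀ x y, s (b x y) = - b (s x) (s y))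
    (P : ℝ × ℝ → E) (hP : ContDiff ℝ (⊤ : ℕ∞) P) (hherm : ∀ p, s (P p) = P p)
    (hEL : ∀ p, b (dpg (fun q => dmg P q) p) (P p) = 0) :
    ∃ F : ℝ × ℝ → E, ContDiff ℝ (⊤ : ℕ∞) F ∧
      (∀ p, dpg F p = (-Complex.I) • b (dpg P p) (P p)) ∧
      (∀ p, dmg F p = Complex.I • b (dmg P p) (P p)) ∧
      (∀ p, s (F p) = -F p) := by
  have hcs : ∀ (c : ℝ) (x : E), c • x = (c : ℂ) • x := fun c x => by
    rw [← one_smul ℂ x, ← smul_assoc, smul_smul, Complex.real_smul]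
  have : CompleteSpace E := FiniteDimensional.complete ℝ E
  obtain ⟨B, hBa⟩ : ∃ B : E →L[ℝ] E →L[ℝ] E, ∀ x y, B x y = b x y :=
    ⟨LinearMap.toContinuousBilinearMap (LinearMap.mk₂ ℝ b hb1
      (fun c x y => by rw [hcs, hcs, hb2]) hb3 (fun c x y => by rw [hcs, hcs, hb4])),
      fun x y => rfl⟩
  obtain ⟨S, hSa⟩ : ∃ S : E →L[ℝ] E, ∀ x, S x = s x :=
    ⟨LinearMap.toContinuousLinearMap
      { toFun := s, map_add' := hs1, map_smul' := hs2 }, fun x => rfl⟩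
  have hP1 : ContDiff ℝ (⊤ : ℕ∞) (fderiv ℝ P) := hP.fderiv_right (by simp)
  have hII : ∀ x : E, Complex.I • Complex.I • x = -x := by
    intro x; rw [smul_smul, Complex.I_mul_I, neg_one_smul]
  have hlap : ∀ p, dpg (fun q => dmg P q) p = (4 : ℂ)⁻¹ • (fderiv ℝ (fderiv ℝ P) p (1, 0) (1, 0) +
      fderiv ℝ (fderiv ℝ P) p (0, 1) (0, 1)) := by
    intro p
    have h2 : HasFDerivAt (fderiv ℝ P) (fderiv ℝ (fderiv ℝ P) p) p :=
      (hP1.differentiable (by simp) p).hasFDerivAt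
    have hsym : fderiv ℝ (fderiv ℝ P) p (1, 0) (0, 1) = fderiv ℝ (fderiv ℝ P) p (0, 1) (1, 0) :=
      (hP.contDiffAt.isSymmSndFDerivAt (by simp; exact WithTop.coe_le_coe.2 le_top)) _ _
    have hx := h2.clm_apply (hasFDerivAt_const ((1 : ℝ), (0 : ℝ)) p)
    have hy := h2.clm_apply (hasFDerivAt_const ((0 : ℝ), (1 : ℝ)) p)
    have hd : ∀ v, fderiv ℝ (fun q => dmg P q) p v = (2 : ℂ)⁻¹ •
        (fderiv ℝ (fderiv ℝ P) p v (1, 0) + Complex.I • fderiv ℝ (fderiv ℝ P) p v (0, 1)) := by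
      intro v
      have h7 : HasFDerivAt (fun q => dmg P q) _ p :=
        ((hx.add (hy.const_smul Complex.I)).const_smul (2 : ℂ)⁻¹)
      rw [h7.fderiv]
      simp
    rw [dpg, hd, hd, hsym]
    rw [smul_comm Complex.I (2 : ℂ)⁻¹, smul_add Complex.I, hII, ← smul_sub, smul_smul]
    congr 1
    · norm_num
    · abel
  obtain ⟨F, hF, hFx, hFy⟩ := closed_aux B (fun a => by rw [hBa, hb]) P hP (by
    intro p
    have := hEL p
    rw [hlap, hb2] at this
    rw [hBa]
    exact (smul_eq_zero.mp this).resolve_left (by norm_num))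
  have hPs : ∀ p v, s (fderiv ℝ P p v) = fderiv ℝ P p v := by
    intro p v
    have h1 := (hP.differentiable (by simp) p).hasFDerivAt
    have h2 := S.hasFDerivAt.comp p h1
    have h3 : (S ∘ P) = P := funext fun q => (hSa _).trans (hherm q)
    rw [h3] at h2
    exact (hSa _).symm.trans (congrArg (fun L => L v) (h2.unique h1))
  let L : E →L[ℝ] E := (2 : ℝ)⁻¹ • (ContinuousLinearMap.id ℝ _ - S)
  have hL : ∀ x, s x = -x → L x = x := by
    intro x hx
    simp only [L, _root_.smul_apply, _root_.sub_apply, ContinuousLinearMap.id_apply, hSa, hx]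
    module
  have hG : ∀ p v, fderiv ℝ (L ∘ F) p v = L (fderiv ℝ F p v) := by
    intro p v
    rw [(L.hasFDerivAt.comp p (hF.differentiable (by simp) p).hasFDerivAt).fderiv]
    rfl
  have hsk : ∀ p v, s (b (fderiv ℝ P p v) (P p)) = -b (fderiv ℝ P p v) (P p) := by
    intro p v
    rw [hsb, hPs, hherm]
  have hGx : ∀ p, fderiv ℝ (L ∘ F) p (1, 0) = -b (fderiv ℝ P p (0, 1)) (P p) := by
    intro p
    rw [hG, hFx, map_neg, hBa, hL _ (hsk _ _)]
  have hGy : ∀ p, fderiv ℝ (L ∘ F) p (0, 1) = b (fderiv ℝ P p (1, 0)) (P p) := by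
    intro p
    rw [hG, hFy, hBa, hL _ (hsk _ _)]
  have hbs : ∀ x y z, b (x - y) z = b x z - b y z := by
    intro x y z
    rw [eq_sub_iff_add_eq, ← hb1, sub_add_cancel]
  refine ⟨L ∘ F, L.contDiff.comp hF, ?_, ?_, ?_⟩
  · intro p
    rw [dpg, dpg, hGx, hGy, hb2, hbs, hb2, smul_comm (-Complex.I), smul_sub (-Complex.I),
      neg_smul, neg_smul, hII]
    congr 1
    abel
  · intro p
    rw [dmg, dmg, hGx, hGy, hb2, hb1, hb2, smul_comm Complex.I (2 : ℂ)⁻¹, smul_add Complex.I, hII]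
    congr 1
    abel
  · intro p
    have : S (L (F p)) = - L (F p) := by
      simp only [L, _root_.smul_apply, _root_.sub_apply, ContinuousLinearMap.id_apply, map_smul,
        map_sub]
      rw [show S (S (F p)) = F p by rw [hSa, hSa, hss]]
      module
    exact (hSa _).symm.trans this

/-- If `P` is a smooth rank-one Hermitian projector solution of the Euler–Lagrange equation,
there exists a smooth skew-Hermitian `F` with `∂₊F = −i[∂₊P, P]` and `∂₋F = i[∂₋P, P]`
(the Generalized Weierstrass formula for immersion). -/
theorem generalized_Weierstrass_immersion_exists {N : ℕ}
    (P : ℝ × ℝ → Matrix (Fin N) (Fin N) ℂ)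
    (hP : ContDiff ℝ (⊤ : ℕ∞) P)
    (hproj : ∀ p, P p * P p = P p)
    (hherm : ∀ p, (P p)ᴴ = P p)
    (htr : ∀ p, (P p).trace = 1)
    (hEL : ∀ p, dp (fun q => dm P q) p * P p - P p * dp (fun q => dm P q) p = 0) :
    ∃ F : ℝ × ℝ → Matrix (Fin N) (Fin N) ℂ, ContDiff ℝ (⊤ : ℕ∞) F ∧
      (∀ p, dp F p = (-Complex.I) • (dp P p * P p - P p * dp P p)) ∧
      (∀ p, dm F p = Complex.I • (dm P p * P p - P p * dm P p)) ∧
      (∀ p, (F p)ᴴ = -F p) := by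
  have : FiniteDimensional ℝ (Matrix (Fin N) (Fin N) ℂ) := inferInstance
  exact abstract_immersion (E := Matrix (Fin N) (Fin N) ℂ) (fun A C => A * C - C * A)
    (fun x x' y => by simp only [add_mul, mul_add]; abel)
    (fun c x y => by simp only [smul_mul_assoc, mul_smul_comm, smul_sub])
    (fun x y y' => by simp only [add_mul, mul_add]; abel)
    (fun c x y => by simp only [smul_mul_assoc, mul_smul_comm, smul_sub])
    (fun x => sub_self _)
    (fun A => Aᴴ) (fun x y => Matrix.conjTranspose_add x y)
    (fun c x => by ext i j; simp) (fun x => Matrix.conjTranspose_conjTranspose x)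
    (fun x y => by simp only [Matrix.conjTranspose_sub, Matrix.conjTranspose_mul]; abel)
    P hP hherm hEL
end
end

section
/- Let P : ℝ² → Matrix (Fin N) (Fin N) ℂ be a smooth rank-one Hermitian projector (P² = P, Pᴴ = P, tr P = 1 everywhere) satisfying the Euler–Lagrange equation [∂₊∂₋P, P] = 0, with finite action ∫_{ℝ²} trace(∂₊P·∂₋P) dx dy < ∞, and suppose t(x,y) := trace(∂₊P·P·∂₋P) is nowhere zero. Then Π₊P := (∂₊P·P·∂₋P)/t is itself a smooth rank-one Hermitian projector satisfying the Euler–Lagrange equation [∂₊∂₋(Π₊P), Π₊P] = 0 with finite action. -/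
open Matrix

noncomputable section

attribute [local instance] Matrix.normedAddCommGroup Matrix.normedSpace

open MeasureTheory

/-- Generic first-order operator `½(∂ₓ + ε ∂_y)`. -/
def wd {V : Type*} [NormedAddCommGroup V] [NormedSpace ℝ V] [NormedSpace ℂ V] (ε : ℂ)
    (f : ℝ × ℝ → V) (p : ℝ × ℝ) : V :=
  (2 : ℂ)⁻¹ • (fderiv ℝ f p (1, 0) + ε • fderiv ℝ f p (0, 1))

lemma dp_eq_wd {N : ℕ} (P : ℝ × ℝ → Matrix (Fin N) (Fin N) ℂ) : dp P = wd (-Complex.I) P := by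
  funext p
  have : ∀ x y : Matrix (Fin N) (Fin N) ℂ,
      (2 : ℂ)⁻¹ • (x - Complex.I • y) = (2 : ℂ)⁻¹ • (x + (-Complex.I) • y) := by
    intro x y
    rw [neg_smul, sub_eq_add_neg]
  exact this _ _

lemma dm_eq_wd {N : ℕ} (P : ℝ × ℝ → Matrix (Fin N) (Fin N) ℂ) : dm P = wd Complex.I P := rfl

section generic
set_option linter.unusedSectionVars false
variable {V : Type*} [NormedAddCommGroup V] [NormedSpace ℝ V] [NormedSpace ℂ V]
  [IsScalarTower ℝ ℂ V]
  {V' : Type*} [NormedAddCommGroup V'] [NormedSpace ℝ V'] [NormedSpace ℂ V']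
  [IsScalarTower ℝ ℂ V']
  {V₂ : Type*} [NormedAddCommGroup V₂] [NormedSpace ℝ V₂] [NormedSpace ℂ V₂]
  [IsScalarTower ℝ ℂ V₂]

lemma smooth_pd {f : ℝ × ℝ → V} (hf : ContDiff ℝ (⊤ : ℕ∞) f) (v : ℝ × ℝ) :
    ContDiff ℝ (⊤ : ℕ∞) (fun p => fderiv ℝ f p v) :=
  (hf.fderiv_right (m := (⊤ : ℕ∞)) (by simp)).clm_apply contDiff_const

lemma smooth_wd (ε : ℂ) {f : ℝ × ℝ → V} (hf : ContDiff ℝ (⊤ : ℕ∞) f) :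
    ContDiff ℝ (⊤ : ℕ∞) (wd ε f) := by
  have h2 : ContDiff ℝ (⊤ : ℕ∞) (fun p => ε • fderiv ℝ f p (0, 1)) :=
    contDiff_const.smul (smooth_pd hf _)
  exact contDiff_const.smul ((smooth_pd hf _).add h2)

lemma wd_clm (ε : ℂ) (L : V →L[ℝ] V') (hL : ∀ (c : ℂ) x, L (c • x) = c • L x)
    {f : ℝ × ℝ → V} (hf : ContDiff ℝ (⊤ : ℕ∞) f) (p : ℝ × ℝ) :
    wd ε (fun q => L (f q)) p = L (wd ε f p) := by
  have h := (L.hasFDerivAt.comp p (hf.differentiable (by simp) p).hasFDerivAt).fderiv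
  change fderiv ℝ (fun q => L (f q)) p = _ at h
  simp [wd, h, hL]

lemma wd_bilin (ε : ℂ) (B : V →L[ℝ] V' →L[ℝ] V₂) (hl : ∀ (c : ℂ) x y, B (c • x) y = c • B x y)
    (hr : ∀ (c : ℂ) x y, B x (c • y) = c • B x y)
    {f : ℝ × ℝ → V} {g : ℝ × ℝ → V'} (hf : ContDiff ℝ (⊤ : ℕ∞) f) (hg : ContDiff ℝ (⊤ : ℕ∞) g)
    (p : ℝ × ℝ) :
    wd ε (fun q => B (f q) (g q)) p = B (wd ε f p) (g p) + B (f p) (wd ε g p) := by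
  have h := B.fderiv_of_bilinear (hf.differentiable (by simp) p) (hg.differentiable (by simp) p)
  simp only [wd, h, hl, hr, map_add, _root_.add_apply,
    ContinuousLinearMap.precompR_apply, ContinuousLinearMap.precompL_apply, ContinuousLinearMap.compL_apply,
    ContinuousLinearMap.comp_apply, smul_add]
  abel

lemma wd_comm (ε δ : ℂ) {f : ℝ × ℝ → V} (hf : ContDiff ℝ (⊤ : ℕ∞) f) (p : ℝ × ℝ) :
    wd ε (wd δ f) p = wd δ (wd ε f) p := by
  have hs : ∀ v w : ℝ × ℝ, fderiv ℝ (fun q => fderiv ℝ f q v) p w =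
      fderiv ℝ (fun q => fderiv ℝ f q w) p v := by
    intro v w
    have hd : DifferentiableAt ℝ (fderiv ℝ f) p :=
      ((hf.fderiv_right (m := (⊤ : ℕ∞)) (by simp)).differentiable (by simp)) p
    have h1 : ∀ v : ℝ × ℝ, ∀ w, fderiv ℝ (fun q => fderiv ℝ f q v) p w
        = fderiv ℝ (fderiv ℝ f) p w v := by
      intro v w
      rw [fderiv_clm_apply hd (differentiableAt_const v)]
      simp
    rw [h1, h1]
    exact (hf.contDiffAt.isSymmSndFDerivAt (by simp; exact WithTop.coe_le_coe.2 (le_top : (2 : ℕ∞) ≤ ⊤))).eq w v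
  have key : ∀ δ : ℂ, ∀ w, fderiv ℝ (wd δ f) p w = (2 : ℂ)⁻¹ •
      (fderiv ℝ (fun q => fderiv ℝ f q (1, 0)) p w
        + δ • fderiv ℝ (fun q => fderiv ℝ f q (0, 1)) p w) := by
    intro δ w
    have h1 := ((smooth_pd hf (1, 0)).differentiable (by simp) p)
    have h2 := ((smooth_pd hf (0, 1)).differentiable (by simp) p)
    have := ((h1.hasFDerivAt.add (h2.hasFDerivAt.const_smul δ)).const_smul (2 : ℂ)⁻¹).fderiv
    change fderiv ℝ (wd δ f) p = _ at this
    rw [this]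
    simp
  simp only [wd.eq_1 ε (wd δ f), wd.eq_1 δ (wd ε f), key]
  rw [hs (0, 1) (1, 0)]
  module


/-- A real-linear map between finite-dimensional spaces, given by equations. -/
lemma exists_clm [FiniteDimensional ℝ V] (L : V → V') (ha : ∀ x y, L (x + y) = L x + L y)
    (hs : ∀ (c : ℝ) x, L (c • x) = c • L x) : ∃ T : V →L[ℝ] V', ∀ x, T x = L x :=
  ⟨LinearMap.toContinuousLinearMap ⟨⟨L, ha⟩, hs⟩, fun _ => rfl⟩

lemma exists_bil [FiniteDimensional ℝ V] [FiniteDimensional ℝ V'] (B : V → V' → V₂)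
    (hal : ∀ x x' y, B (x + x') y = B x y + B x' y)
    (har : ∀ x y y', B x (y + y') = B x y + B x y')
    (hsl : ∀ (c : ℝ) x y, B (c • x) y = c • B x y)
    (hsr : ∀ (c : ℝ) x y, B x (c • y) = c • B x y) :
    ∃ T : V →L[ℝ] V' →L[ℝ] V₂, ∀ x y, T x y = B x y :=
  ⟨(LinearMap.mk₂ ℝ B hal hsl har hsr).toContinuousBilinearMap, fun _ _ => rfl⟩

lemma smooth_lin [FiniteDimensional ℝ V] (L : V → V') (ha : ∀ x y, L (x + y) = L x + L y)
    (hs : ∀ (c : ℝ) x, L (c • x) = c • L x) {f : ℝ × ℝ → V} (hf : ContDiff ℝ (⊤ : ℕ∞) f) :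
    ContDiff ℝ (⊤ : ℕ∞) (fun p => L (f p)) := by
  obtain ⟨T, hT⟩ := exists_clm L ha hs
  simp only [← hT]
  exact T.contDiff.comp hf

lemma smooth_bil [FiniteDimensional ℝ V] [FiniteDimensional ℝ V'] (B : V → V' → V₂)
    (hal : ∀ x x' y, B (x + x') y = B x y + B x' y)
    (har : ∀ x y y', B x (y + y') = B x y + B x y')
    (hsl : ∀ (c : ℝ) x y, B (c • x) y = c • B x y)
    (hsr : ∀ (c : ℝ) x y, B x (c • y) = c • B x y)
    {f : ℝ × ℝ → V} {g : ℝ × ℝ → V'} (hf : ContDiff ℝ (⊤ : ℕ∞) f) (hg : ContDiff ℝ (⊤ : ℕ∞) g) :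
    ContDiff ℝ (⊤ : ℕ∞) (fun p => B (f p) (g p)) := by
  obtain ⟨T, hT⟩ := exists_bil B hal har hsl hsr
  simp only [← hT]
  exact (T.contDiff.comp hf).clm_apply hg

lemma wd_lin [FiniteDimensional ℝ V] (ε : ℂ) (L : V → V') (ha : ∀ x y, L (x + y) = L x + L y)
    (hs : ∀ (c : ℝ) x, L (c • x) = c • L x) (hsc : ∀ (c : ℂ) x, L (c • x) = c • L x)
    {f : ℝ × ℝ → V} (hf : ContDiff ℝ (⊤ : ℕ∞) f) (p : ℝ × ℝ) :
    wd ε (fun q => L (f q)) p = L (wd ε f p) := by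
  obtain ⟨T, hT⟩ := exists_clm L ha hs
  simp only [← hT] at hsc ⊢
  exact wd_clm ε T hsc hf p

lemma wd_antilin [FiniteDimensional ℝ V] (ε : ℂ) (L : V → V') (ha : ∀ x y, L (x + y) = L x + L y)
    (hs : ∀ (c : ℝ) x, L (c • x) = c • L x) (hsc : ∀ (c : ℂ) x, L (c • x) = star c • L x)
    {f : ℝ × ℝ → V} (hf : ContDiff ℝ (⊤ : ℕ∞) f) (p : ℝ × ℝ) :
    wd ε (fun q => L (f q)) p = L (wd (star ε) f p) := by
  obtain ⟨T, hT⟩ := exists_clm L ha hs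
  simp only [← hT] at hsc ⊢
  have h := (T.hasFDerivAt.comp p (hf.differentiable (by simp) p).hasFDerivAt).fderiv
  change fderiv ℝ (fun q => T (f q)) p = _ at h
  simp [wd, h, hsc]

lemma wd_bil [FiniteDimensional ℝ V] [FiniteDimensional ℝ V'] (ε : ℂ) (B : V → V' → V₂)
    (hal : ∀ x x' y, B (x + x') y = B x y + B x' y)
    (har : ∀ x y y', B x (y + y') = B x y + B x y')
    (hsl : ∀ (c : ℝ) x y, B (c • x) y = c • B x y)
    (hsr : ∀ (c : ℝ) x y, B x (c • y) = c • B x y)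
    (hl : ∀ (c : ℂ) x y, B (c • x) y = c • B x y)
    (hr : ∀ (c : ℂ) x y, B x (c • y) = c • B x y)
    {f : ℝ × ℝ → V} {g : ℝ × ℝ → V'} (hf : ContDiff ℝ (⊤ : ℕ∞) f) (hg : ContDiff ℝ (⊤ : ℕ∞) g)
    (p : ℝ × ℝ) :
    wd ε (fun q => B (f q) (g q)) p = B (wd ε f p) (g p) + B (f p) (wd ε g p) := by
  obtain ⟨T, hT⟩ := exists_bil B hal har hsl hsr
  simp only [← hT] at hl hr ⊢
  exact wd_bilin ε T hl hr hf hg p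

lemma wd_sub' (ε : ℂ) {f g : ℝ × ℝ → V} (hf : ContDiff ℝ (⊤ : ℕ∞) f)
    (hg : ContDiff ℝ (⊤ : ℕ∞) g) (p : ℝ × ℝ) :
    wd ε (fun q => f q - g q) p = wd ε f p - wd ε g p := by
  have h := ((hf.differentiable (by simp) p).hasFDerivAt.sub
    (hg.differentiable (by simp) p).hasFDerivAt).fderiv
  change fderiv ℝ (fun q => f q - g q) p = _ at h
  simp only [wd, h, _root_.sub_apply, smul_sub, smul_add]
  abel

end generic

section mat
variable {N : ℕ}

variable {f g : ℝ × ℝ → Matrix (Fin N) (Fin N) ℂ} {c d : ℝ × ℝ → ℂ}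

lemma smooth_mul (hf : ContDiff ℝ (⊤ : ℕ∞) f) (hg : ContDiff ℝ (⊤ : ℕ∞) g) :
    ContDiff ℝ (⊤ : ℕ∞) (fun p => f p * g p) :=
  smooth_bil (fun x y : Matrix (Fin N) (Fin N) ℂ => x * y) (fun _ _ _ => add_mul _ _ _)
    (fun _ _ _ => mul_add _ _ _) (fun _ _ _ => smul_mul_assoc _ _ _)
    (fun _ _ _ => mul_smul_comm _ _ _) hf hg

lemma smooth_tr (hf : ContDiff ℝ (⊤ : ℕ∞) f) : ContDiff ℝ (⊤ : ℕ∞) (fun p => (f p).trace) :=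
  smooth_lin (fun x : Matrix (Fin N) (Fin N) ℂ => x.trace) (fun _ _ => Matrix.trace_add _ _)
    (fun _ _ => Matrix.trace_smul _ _) hf

lemma ct_smul_real (c : ℝ) (x : Matrix (Fin N) (Fin N) ℂ) : (c • x)ᴴ = c • xᴴ := by
  simp

lemma smooth_ct (hf : ContDiff ℝ (⊤ : ℕ∞) f) : ContDiff ℝ (⊤ : ℕ∞) (fun p => (f p)ᴴ) :=
  smooth_lin (fun x : Matrix (Fin N) (Fin N) ℂ => xᴴ) (fun _ _ => Matrix.conjTranspose_add _ _)
    (fun c x => ct_smul_real c x) hf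

lemma smooth_smul (hc : ContDiff ℝ (⊤ : ℕ∞) c) (hf : ContDiff ℝ (⊤ : ℕ∞) f) :
    ContDiff ℝ (⊤ : ℕ∞) (fun p => c p • f p) :=
  smooth_bil (fun (x : ℂ) (y : Matrix (Fin N) (Fin N) ℂ) => x • y) (fun _ _ _ => add_smul _ _ _)
    (fun _ _ _ => smul_add _ _ _) (fun _ _ _ => smul_assoc _ _ _)
    (fun _ _ _ => smul_comm _ _ _) hc hf

lemma wd_mul (ε : ℂ) (hf : ContDiff ℝ (⊤ : ℕ∞) f) (hg : ContDiff ℝ (⊤ : ℕ∞) g) (p : ℝ × ℝ) :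
    wd ε (fun q => f q * g q) p = wd ε f p * g p + f p * wd ε g p :=
  wd_bil ε (fun x y : Matrix (Fin N) (Fin N) ℂ => x * y) (fun _ _ _ => add_mul _ _ _)
    (fun _ _ _ => mul_add _ _ _) (fun _ _ _ => smul_mul_assoc _ _ _)
    (fun _ _ _ => mul_smul_comm _ _ _) (fun _ _ _ => smul_mul_assoc _ _ _)
    (fun _ _ _ => mul_smul_comm _ _ _) hf hg p

lemma wd_smul (ε : ℂ) (hc : ContDiff ℝ (⊤ : ℕ∞) c) (hg : ContDiff ℝ (⊤ : ℕ∞) g) (p : ℝ × ℝ) :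
    wd ε (fun q => c q • g q) p = wd ε c p • g p + c p • wd ε g p :=
  wd_bil ε (fun (x : ℂ) (y : Matrix (Fin N) (Fin N) ℂ) => x • y) (fun _ _ _ => add_smul _ _ _)
    (fun _ _ _ => smul_add _ _ _) (fun _ _ _ => smul_assoc _ _ _)
    (fun _ _ _ => smul_comm _ _ _) (fun _ _ _ => smul_assoc _ _ _)
    (fun _ _ _ => smul_comm _ _ _) hc hg p

lemma wd_cmul (ε : ℂ) (hc : ContDiff ℝ (⊤ : ℕ∞) c) (hd : ContDiff ℝ (⊤ : ℕ∞) d) (p : ℝ × ℝ) :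
    wd ε (fun q => c q * d q) p = wd ε c p * d p + c p * wd ε d p :=
  wd_bilin ε (ContinuousLinearMap.mul ℝ ℂ) (fun c x y => by simp [mul_assoc])
    (fun c x y => by simp [mul_left_comm]) hc hd p


lemma wd_tr (ε : ℂ) (hf : ContDiff ℝ (⊤ : ℕ∞) f) (p : ℝ × ℝ) :
    wd ε (fun q => (f q).trace) p = (wd ε f p).trace :=
  wd_lin ε (fun x : Matrix (Fin N) (Fin N) ℂ => x.trace) (fun _ _ => Matrix.trace_add _ _)
    (fun _ _ => Matrix.trace_smul _ _) (fun _ _ => Matrix.trace_smul _ _) hf p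

lemma wd_ct (ε : ℂ) (hf : ContDiff ℝ (⊤ : ℕ∞) f) (p : ℝ × ℝ) :
    wd ε (fun q => (f q)ᴴ) p = (wd (star ε) f p)ᴴ :=
  wd_antilin ε (fun x : Matrix (Fin N) (Fin N) ℂ => xᴴ) (fun _ _ => Matrix.conjTranspose_add _ _)
    (fun c x => ct_smul_real c x) (fun _ _ => Matrix.conjTranspose_smul _ _) hf p

lemma wd_sub (ε : ℂ) (hf : ContDiff ℝ (⊤ : ℕ∞) f) (hg : ContDiff ℝ (⊤ : ℕ∞) g) (p : ℝ × ℝ) :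
    wd ε (fun q => f q - g q) p = wd ε f p - wd ε g p := wd_sub' ε hf hg p

lemma wd_zero {V : Type*} [NormedAddCommGroup V] [NormedSpace ℝ V] [NormedSpace ℂ V]
    (ε : ℂ) (v : V) (p : ℝ × ℝ) : wd ε (fun _ : ℝ × ℝ => v) p = 0 := by
  simp [wd]

lemma rank_one_sandwich (P X : Matrix (Fin N) (Fin N) ℂ) (h : P * P = P) (ht : P.trace = 1) :
    P * X * P = (P * X).trace • P := by
  have hi : IsIdempotentElem (Matrix.toLin' P) := by
    rw [IsIdempotentElem, Module.End.mul_eq_comp, ← Matrix.toLin'_mul, h]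
  have h1 := (LinearMap.IsIdempotentElem.isProj_range _ hi).trace
  rw [Matrix.trace_toLin'_eq, ht] at h1
  have h2 : Module.finrank ℂ (LinearMap.range (Matrix.toLin' P)) = 1 := by exact_mod_cast h1.symm
  obtain ⟨⟨v, hv⟩, hv0, hvs⟩ := finrank_eq_one_iff'.1 h2
  have h3 : ∀ x : Fin N → ℂ, ∃ c : ℂ, P *ᵥ x = c • v := by
    intro x
    obtain ⟨c, hc⟩ := hvs ⟨P *ᵥ x, ⟨x, by simp⟩⟩
    exact ⟨c, by simpa using (congrArg Subtype.val hc).symm⟩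
  choose w hw using fun j => h3 (Pi.single j 1)
  have hP : P = Matrix.vecMulVec v w := by
    ext i j
    have := congrFun (hw j) i
    simp [Matrix.vecMulVec] at this ⊢
    rw [this, mul_comm]
  rw [hP]
  simp only [Matrix.vecMulVec_mul, Matrix.trace_vecMulVec]
  rw [dotProduct_comm]
  ext i j
  simp [Matrix.vecMulVec, Matrix.vecMul, dotProduct, Finset.sum_mul]
  rw [Finset.mul_sum]
  refine Finset.sum_congr rfl fun k _ => ?_
  rw [Finset.mul_sum]
  refine Finset.sum_congr rfl fun l _ => ?_
  ring

end mat

section alg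
set_option linter.unusedSectionVars false
variable {R : Type*} [Ring R] [Algebra ℂ R]

lemma alg_PxP (P a : R) (hP : P * P = P) (ha : a * P + P * a = a) : P * a * P = 0 := by
  have h := congrArg (fun x => P * x * P) ha
  simp only [mul_add, add_mul] at h
  have h1 : P * (a * P) * P = P * a * P := by simp only [mul_assoc, hP]
  have h2 : P * (P * a) * P = P * a * P := by simp only [← mul_assoc, hP]
  rw [h1, h2] at h
  simpa using h

/-- second order consequence: `c P = -(t+s) P` -/
lemma alg_cP (P a b c : R) (t s : ℂ) (hP : P * P = P)
    (hc : c * P + b * a + (a * b + P * c) = c) (hEL : c * P = P * c)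
    (ht : P * (b * a) * P = t • P) (hs : P * (a * b) * P = s • P) : c * P = -((t + s) • P) := by
  have h := congrArg (fun x => P * x * P) hc
  simp only [mul_add, add_mul] at h
  have h1 : P * (c * P) * P = c * P := by rw [hEL, ← mul_assoc, hP, mul_assoc, hEL, ← mul_assoc, hP]
  have h2 : P * (P * c) * P = c * P := by rw [← hEL, h1]
  have h3 : P * c * P = c * P := by rw [← hEL, mul_assoc, hP]
  rw [h1, h2, h3, ht, hs] at h
  linear_combination (norm := module) h

lemma alg_dA (P a b c : R) (t s : ℂ) (hP : P * P = P) (ha : a * P + P * a = a)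
    (hb : b * P + P * b = b) (hs : P * (a * b) * P = s • P) (hcP : c * P = -((t + s) • P)) :
    c * P + a * b = a * P * b - t • P := by
  have hPb := alg_PxP P b hP hb
  have h1 : a * b * P = s • P := by
    calc a * b * P = (a * P + P * a) * b * P := by rw [ha]
      _ = a * (P * b * P) + P * (a * b) * P := by noncomm_ring
      _ = _ := by rw [hPb, hs]; simp
  have h2 : a * b = a * P * b + a * b * P := by
    calc a * b = a * (b * P + P * b) := by rw [hb]
      _ = _ := by noncomm_ring
  rw [h2, h1, hcP]
  module

/-- `A a β`-type identity -/
lemma alg_ab (P a b B β : R) (s : ℂ) (hP : P * P = P) (ha : a * P + P * a = a)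
    (hs : P * (a * b) * P = s • P) (hB : P * B = B) (hβ : b * B + P * β = β) :
    P * a * β = s • B := by
  have hPa := alg_PxP P a hP ha
  calc P * a * β = P * a * (b * B + P * β) := by rw [hβ]
    _ = P * (a * b) * B + P * a * P * β := by noncomm_ring
    _ = P * (a * b) * (P * B) + P * a * P * β := by rw [hB]
    _ = (P * (a * b) * P) * B + P * a * P * β := by noncomm_ring
    _ = _ := by rw [hs, hPa, smul_mul_assoc, hB]; simp

end alg

section main
variable {N : ℕ}

structure Sol (P : ℝ × ℝ → Matrix (Fin N) (Fin N) ℂ) : Prop where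
  smooth : ContDiff ℝ (⊤ : ℕ∞) P
  proj : ∀ p, P p * P p = P p
  herm : ∀ p, (P p)ᴴ = P p
  tr : ∀ p, (P p).trace = 1
  EL : ∀ p, wd (-Complex.I) (wd Complex.I P) p * P p = P p * wd (-Complex.I) (wd Complex.I P) p

variable {P : ℝ × ℝ → Matrix (Fin N) (Fin N) ℂ}

lemma wd_congr {V : Type*} [NormedAddCommGroup V] [NormedSpace ℝ V] [NormedSpace ℂ V]
    (ε : ℂ) {f g : ℝ × ℝ → V} (h : ∀ p, f p = g p) (p : ℝ × ℝ) : wd ε f p = wd ε g p := by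
  rw [show f = g from funext h]

/-- `A = ∂₊P P` -/
def fA (P : ℝ × ℝ → Matrix (Fin N) (Fin N) ℂ) (p : ℝ × ℝ) : Matrix (Fin N) (Fin N) ℂ :=
  wd (-Complex.I) P p * P p

/-- `B = P ∂₋P` -/
def fB (P : ℝ × ℝ → Matrix (Fin N) (Fin N) ℂ) (p : ℝ × ℝ) : Matrix (Fin N) (Fin N) ℂ :=
  P p * wd Complex.I P p

def ft (P : ℝ × ℝ → Matrix (Fin N) (Fin N) ℂ) (p : ℝ × ℝ) : ℂ :=
  (wd (-Complex.I) P p * P p * wd Complex.I P p).trace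

def fs (P : ℝ × ℝ → Matrix (Fin N) (Fin N) ℂ) (p : ℝ × ℝ) : ℂ :=
  (P p * (wd (-Complex.I) P p * wd Complex.I P p)).trace

namespace Sol

lemma sA (h : Sol P) : ContDiff ℝ (⊤ : ℕ∞) (fA P) := smooth_mul (smooth_wd _ h.smooth) h.smooth
lemma sB (h : Sol P) : ContDiff ℝ (⊤ : ℕ∞) (fB P) := smooth_mul h.smooth (smooth_wd _ h.smooth)
lemma st (h : Sol P) : ContDiff ℝ (⊤ : ℕ∞) (ft P) :=
  smooth_tr (smooth_mul (smooth_mul (smooth_wd _ h.smooth) h.smooth) (smooth_wd _ h.smooth))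

lemma d1 (h : Sol P) (ε : ℂ) (p) : wd ε P p * P p + P p * wd ε P p = wd ε P p := by
  rw [← wd_mul ε h.smooth h.smooth]
  exact wd_congr ε h.proj p

lemma ctm (h : Sol P) (p) : (wd Complex.I P p)ᴴ = wd (-Complex.I) P p := by
  have := wd_ct (-Complex.I) h.smooth p
  rw [wd_congr _ h.herm] at this
  simpa using this.symm

lemma ctp (h : Sol P) (p) : (wd (-Complex.I) P p)ᴴ = wd Complex.I P p := by
  rw [← h.ctm, Matrix.conjTranspose_conjTranspose]

lemma AH (h : Sol P) (p) : (fA P p)ᴴ = fB P p := by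
  simp [fA, fB, h.ctp, h.herm]

lemma BH (h : Sol P) (p) : (fB P p)ᴴ = fA P p := by
  rw [← h.AH, Matrix.conjTranspose_conjTranspose]

lemma sand_t (h : Sol P) (p) :
    P p * (wd Complex.I P p * wd (-Complex.I) P p) * P p = ft P p • P p := by
  rw [rank_one_sandwich _ _ (h.proj p) (h.tr p), ft]
  congr 1
  rw [← Matrix.mul_assoc, Matrix.trace_mul_comm, Matrix.mul_assoc]

lemma sand_s (h : Sol P) (p) :
    P p * (wd (-Complex.I) P p * wd Complex.I P p) * P p = fs P p • P p := by
  rw [rank_one_sandwich _ _ (h.proj p) (h.tr p), fs]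

lemma ft_AB (h : Sol P) (p) : fA P p * fB P p = wd (-Complex.I) P p * P p * wd Complex.I P p := by
  simp only [fA, fB, Matrix.mul_assoc]
  rw [← Matrix.mul_assoc (P p) (P p), h.proj]

lemma tr_AB (h : Sol P) (p) : (fA P p * fB P p).trace = ft P p := by
  rw [h.ft_AB, ft]

lemma star_t (h : Sol P) (p) : star (ft P p) = ft P p := by
  rw [← h.tr_AB, ← Matrix.trace_conjTranspose, Matrix.conjTranspose_mul, h.AH, h.BH]

lemma d2 (h : Sol P) (p) : wd (-Complex.I) (wd Complex.I P) p * P p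
    + wd Complex.I P p * wd (-Complex.I) P p
    + (wd (-Complex.I) P p * wd Complex.I P p + P p * wd (-Complex.I) (wd Complex.I P) p)
    = wd (-Complex.I) (wd Complex.I P) p := by
  have hs := smooth_wd Complex.I h.smooth
  rw [← wd_mul _ hs h.smooth, ← wd_mul _ h.smooth hs, ← wd_congr (-Complex.I) (h.d1 Complex.I) p]
  have := wd_sub (-Complex.I) (smooth_mul hs h.smooth)
    (smooth_mul (contDiff_const (c := (-1 : Matrix (Fin N) (Fin N) ℂ))) (smooth_mul h.smooth hs)) p
  rw [wd_mul (-Complex.I) (contDiff_const (c := (-1 : Matrix (Fin N) (Fin N) ℂ)))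
    (smooth_mul h.smooth hs), wd_zero] at this
  simpa using this.symm

lemma cP (h : Sol P) (p) : wd (-Complex.I) (wd Complex.I P) p * P p = -((ft P p + fs P p) • P p) :=
  alg_cP _ _ _ _ _ _ (h.proj p) (h.d2 p) (h.EL p) (h.sand_t p) (h.sand_s p)

lemma dA (h : Sol P) (p) : wd Complex.I (fA P) p = fA P p * wd Complex.I P p - ft P p • P p := by
  have h1 : wd Complex.I (fA P) p = wd (-Complex.I) (wd Complex.I P) p * P p
      + wd (-Complex.I) P p * wd Complex.I P p := by
    rw [wd_comm _ _ h.smooth]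
    exact wd_mul _ (smooth_wd _ h.smooth) h.smooth p
  rw [h1]
  exact alg_dA _ _ _ _ _ _ (h.proj p) (h.d1 _ p) (h.d1 _ p) (h.sand_s p) (h.cP p)

lemma wBH (h : Sol P) (ε p) : wd ε (fB P) p = (wd (star ε) (fA P) p)ᴴ := by
  rw [← wd_ct _ h.sA]
  exact wd_congr _ (fun q => (h.AH q).symm) p

lemma dB (h : Sol P) (p) :
    wd (-Complex.I) (fB P) p = wd (-Complex.I) P p * fB P p - ft P p • P p := by
  rw [h.wBH]
  have := h.dA p
  simp only [star_neg, Complex.star_def, Complex.conj_I, neg_neg, this, Matrix.conjTranspose_sub,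
    Matrix.conjTranspose_mul, Matrix.conjTranspose_smul, h.ctm, h.AH, h.herm, h.star_t]

lemma BA (h : Sol P) (p) : fB P p * fA P p = ft P p • P p := by
  rw [← h.sand_t]; simp only [fA, fB, Matrix.mul_assoc]
lemma PA (h : Sol P) (p) : P p * fA P p = 0 := by
  rw [← alg_PxP _ _ (h.proj p) (h.d1 (-Complex.I) p)]; simp only [fA, Matrix.mul_assoc]
lemma BP (h : Sol P) (p) : fB P p * P p = 0 := by
  rw [← alg_PxP _ _ (h.proj p) (h.d1 (Complex.I) p)]; simp only [fB]
lemma AP (h : Sol P) (p) : fA P p * P p = fA P p := by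
  simp only [fA, Matrix.mul_assoc, h.proj]
lemma PB (h : Sol P) (p) : P p * fB P p = fB P p := by
  simp only [fB, ← Matrix.mul_assoc, h.proj]
lemma BB (h : Sol P) (p) : fB P p * fB P p = 0 := by
  nth_rw 2 [← h.PB]
  rw [← Matrix.mul_assoc, h.BP, Matrix.zero_mul]
lemma AbB (h : Sol P) (p) : fA P p * wd Complex.I P p * fB P p = 0 := by
  rw [← h.AP, Matrix.mul_assoc (fA P p)]
  change fA P p * fB P p * fB P p = 0
  rw [Matrix.mul_assoc, h.BB, Matrix.mul_zero]
lemma aB (h : Sol P) (p) : wd (-Complex.I) P p * fB P p = fA P p * fB P p := by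
  rw [← h.PB, ← Matrix.mul_assoc, h.PB, fA]

lemma dPB (h : Sol P) (ε p) : wd ε P p * fB P p + P p * wd ε (fB P) p = wd ε (fB P) p := by
  rw [← wd_mul ε h.smooth h.sB]
  exact wd_congr ε h.PB p

lemma dt (h : Sol P) (ε p) : wd ε (fB P) p * fA P p + fB P p * wd ε (fA P) p
    = wd ε (ft P) p • P p + ft P p • wd ε P p := by
  rw [← wd_mul ε h.sB h.sA, ← wd_smul ε h.st h.smooth]
  exact wd_congr ε h.BA p

lemma βA (h : Sol P) (p) : wd Complex.I (fB P) p * fA P p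
    = wd Complex.I (ft P) p • P p + ft P p • (wd Complex.I P p * P p) := by
  have h1 := h.dt Complex.I p
  have h2 : fB P p * wd Complex.I (fA P) p = ft P p • fB P p := by
    rw [h.dA, mul_sub, mul_smul_comm, h.BP, ← mul_assoc, h.BA, smul_mul_assoc]
    simp [fB]
  rw [h2] at h1
  rw [← h.d1 Complex.I p] at h1
  rw [smul_add] at h1
  change _ = _ + (_ + ft P p • fB P p) at h1
  rw [← add_assoc] at h1
  exact add_right_cancel h1

lemma tr_βA (h : Sol P) (p) :
    (wd Complex.I (fB P) p * fA P p).trace = wd Complex.I (ft P) p := by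
  rw [h.βA]
  have : (wd Complex.I P p * P p).trace = 0 := by
    rw [← h.proj, ← Matrix.mul_assoc, Matrix.trace_mul_comm, ← Matrix.mul_assoc,
      alg_PxP _ _ (h.proj p) (h.d1 (Complex.I) p), Matrix.trace_zero]
  simp [this, h.tr]



end Sol

/-- the raised projector -/
def fQ (P : ℝ × ℝ → Matrix (Fin N) (Fin N) ℂ) (p : ℝ × ℝ) : Matrix (Fin N) (Fin N) ℂ :=
  (ft P p)⁻¹ • (fA P p * fB P p)

/-- `E = ∂₋Q + B` -/
def fE (P : ℝ × ℝ → Matrix (Fin N) (Fin N) ℂ) (p : ℝ × ℝ) : Matrix (Fin N) (Fin N) ℂ :=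
  wd Complex.I (fQ P) p + fB P p

namespace Sol

lemma sQ (h : Sol P) (h0 : ∀ p, ft P p ≠ 0) : ContDiff ℝ (⊤ : ℕ∞) (fQ P) :=
  smooth_smul (h.st.inv h0) (smooth_mul h.sA h.sB)

lemma tQ (h0 : ∀ p, ft P p ≠ 0) (p) : ft P p • fQ P p = fA P p * fB P p := by
  rw [fQ, smul_inv_smul₀ (h0 p)]

lemma cancel {t : ℂ} (h0 : t ≠ 0) {X Y : Matrix (Fin N) (Fin N) ℂ} (h : t • X = t • Y) : X = Y := by
  have := congrArg (fun Z => t⁻¹ • Z) h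
  simpa only [inv_smul_smul₀ h0] using this

lemma QA (h : Sol P) (h0 : ∀ p, ft P p ≠ 0) (p) : fQ P p * fA P p = fA P p := by
  apply cancel (h0 p)
  rw [← smul_mul_assoc, tQ h0, mul_assoc, h.BA, mul_smul_comm, h.AP]

lemma BQ (h : Sol P) (h0 : ∀ p, ft P p ≠ 0) (p) : fB P p * fQ P p = fB P p := by
  apply cancel (h0 p)
  rw [← mul_smul_comm, tQ h0, ← mul_assoc, h.BA, smul_mul_assoc, h.PB]

lemma QQ (h : Sol P) (h0 : ∀ p, ft P p ≠ 0) (p) : fQ P p * fQ P p = fQ P p := by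
  apply cancel (h0 p)
  rw [← mul_smul_comm, tQ h0, ← mul_assoc, h.QA h0]

lemma QB (h : Sol P) (h0 : ∀ p, ft P p ≠ 0) (p) : fQ P p * fB P p = 0 := by
  apply cancel (h0 p)
  rw [← smul_mul_assoc, tQ h0, mul_assoc, h.BB, mul_zero, smul_zero]

lemma QH (h : Sol P) (p) : (fQ P p)ᴴ = fQ P p := by
  rw [fQ, Matrix.conjTranspose_smul, Matrix.conjTranspose_mul, h.AH, h.BH, star_inv₀, h.star_t]

lemma trQ (h : Sol P) (h0 : ∀ p, ft P p ≠ 0) (p) : (fQ P p).trace = 1 := by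
  rw [fQ, Matrix.trace_smul, h.tr_AB, smul_eq_mul, inv_mul_cancel₀ (h0 p)]

lemma tE (h : Sol P) (h0 : ∀ p, ft P p ≠ 0) (p) : ft P p • fE P p =
    fA P p * wd Complex.I (fB P) p - wd Complex.I (ft P) p • fQ P p := by
  have h1 : wd Complex.I (ft P) p • fQ P p + ft P p • wd Complex.I (fQ P) p
      = wd Complex.I (fA P) p * fB P p + fA P p * wd Complex.I (fB P) p := by
    rw [← wd_smul _ h.st (h.sQ h0), ← wd_mul _ h.sA h.sB]
    exact wd_congr _ (tQ h0) p
  rw [h.dA, sub_mul, h.AbB, smul_mul_assoc, h.PB] at h1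
  rw [fE, smul_add]
  rw [eq_sub_iff_add_eq, add_right_comm, add_comm (ft P p • wd Complex.I (fQ P) p), h1]
  abel

lemma QE (h : Sol P) (h0 : ∀ p, ft P p ≠ 0) (p) : fQ P p * fE P p = fE P p := by
  apply cancel (h0 p)
  rw [← mul_smul_comm, h.tE h0, mul_sub, ← mul_assoc, h.QA h0, mul_smul_comm, h.QQ h0]

lemma EA (h : Sol P) (h0 : ∀ p, ft P p ≠ 0) (p) : fE P p * fA P p = 0 := by
  apply cancel (h0 p)
  rw [← smul_mul_assoc, h.tE h0, sub_mul, mul_assoc, h.βA, mul_add, mul_smul_comm, h.AP,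
    mul_smul_comm, smul_mul_assoc, h.QA h0]
  have : fA P p * (wd Complex.I P p * P p) = 0 := by
    rw [← h.AP, mul_assoc, ← mul_assoc (P p), alg_PxP _ _ (h.proj p) (h.d1 (Complex.I) p), mul_zero]
  rw [this]
  simp

lemma EQ (h : Sol P) (h0 : ∀ p, ft P p ≠ 0) (p) : fE P p * fQ P p = 0 := by
  apply cancel (h0 p)
  rw [← mul_smul_comm, tQ h0, ← mul_assoc, h.EA h0, zero_mul, smul_zero]

lemma dQ (p) : wd Complex.I (fQ P) p = fE P p - fB P p := by
  rw [fE, add_sub_cancel_right]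

lemma eQ (h : Sol P) (h0 : ∀ p, ft P p ≠ 0) (p) :
    wd (-Complex.I) (fQ P) p = (fE P p)ᴴ - fA P p := by
  have := wd_ct (-Complex.I) (h.sQ h0) p
  rw [wd_congr _ h.QH] at this
  simp only [star_neg, Complex.star_def, Complex.conj_I, neg_neg] at this
  rw [this, dQ, Matrix.conjTranspose_sub, h.BH]

lemma AHEH (h : Sol P) (h0 : ∀ p, ft P p ≠ 0) (p) : fB P p * (fE P p)ᴴ = 0 := by
  have := congrArg Matrix.conjTranspose (h.EA h0 p)
  rwa [Matrix.conjTranspose_mul, h.AH, Matrix.conjTranspose_zero] at this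

lemma de (h : Sol P) (h0 : ∀ p, ft P p ≠ 0) (p) :
    wd Complex.I (fQ P) p * wd (-Complex.I) (fQ P) p = fE P p * (fE P p)ᴴ + ft P p • P p := by
  rw [dQ, h.eQ h0, sub_mul, mul_sub, mul_sub, h.EA h0, h.AHEH h0, h.BA]
  abel

lemma cQ (h : Sol P) (h0 : ∀ p, ft P p ≠ 0) (p) :
    wd (-Complex.I) (wd Complex.I (fQ P)) p * fQ P p = -(ft P p • fQ P p) - fE P p * (fE P p)ᴴ := by
  have h1 : ∀ q, wd Complex.I (fQ P) q * fQ P q = (-1 : Matrix (Fin N) (Fin N) ℂ) * fB P q := by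
    intro q
    rw [dQ, sub_mul, h.EQ h0, h.BQ h0]
    simp
  have h2 := wd_congr (-Complex.I) h1 p
  rw [wd_mul _ (smooth_wd _ (h.sQ h0)) (h.sQ h0), wd_mul _ contDiff_const h.sB, wd_zero, h.de h0,
    h.dB, h.aB, ← tQ h0, zero_mul, zero_add, neg_mul, one_mul] at h2
  rw [eq_sub_of_add_eq h2]
  abel

lemma ELQ (h : Sol P) (h0 : ∀ p, ft P p ≠ 0) (p) :
    wd (-Complex.I) (wd Complex.I (fQ P)) p * fQ P p
      = fQ P p * wd (-Complex.I) (wd Complex.I (fQ P)) p := by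
  have hc : (wd (-Complex.I) (wd Complex.I (fQ P)) p)ᴴ = wd (-Complex.I) (wd Complex.I (fQ P)) p := by
    have h1 : ∀ q, (wd Complex.I (fQ P) q)ᴴ = wd (-Complex.I) (fQ P) q := by
      intro q
      rw [h.eQ h0, dQ, Matrix.conjTranspose_sub, h.BH]
    have h2 := wd_ct Complex.I (smooth_wd Complex.I (h.sQ h0)) p
    rw [wd_congr _ h1, wd_comm _ _ (h.sQ h0)] at h2
    simpa using h2.symm
  have h3 := congrArg Matrix.conjTranspose (h.cQ h0 p)
  rw [Matrix.conjTranspose_mul, hc, h.QH] at h3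
  rw [h3, h.cQ h0]
  simp only [Matrix.conjTranspose_sub, Matrix.conjTranspose_neg, Matrix.conjTranspose_smul,
    Matrix.conjTranspose_mul, Matrix.conjTranspose_conjTranspose, h.QH, h.star_t]

lemma LQ (h : Sol P) (h0 : ∀ p, ft P p ≠ 0) (p) :
    (wd (-Complex.I) (fQ P) p * wd Complex.I (fQ P) p).trace
      = (fE P p * (fE P p)ᴴ).trace + ft P p := by
  rw [Matrix.trace_mul_comm, h.de h0, Matrix.trace_add, Matrix.trace_smul, h.tr]
  simp

lemma LP (h : Sol P) (p) :
    (wd (-Complex.I) P p * wd Complex.I P p).trace = ft P p + fs P p := by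
  nth_rw 1 [← h.d1 (-Complex.I) p]
  rw [add_mul, Matrix.trace_add, ft, fs, mul_assoc (P p)]

/-- `∂₊∂₋ t = tr(αβ) - 2t²` -/
lemma ddt (h : Sol P) (p) : wd (-Complex.I) (wd Complex.I (ft P)) p =
    (wd (-Complex.I) (fA P) p * wd Complex.I (fB P) p).trace - 2 * ft P p ^ 2 := by
  have h1 : ∀ q, wd Complex.I (ft P) q = (fA P q * wd Complex.I (fB P) q).trace := by
    intro q
    rw [← h.tr_βA, Matrix.trace_mul_comm]
  have hsβ := smooth_wd Complex.I h.sB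
  rw [wd_congr _ h1, wd_tr _ (smooth_mul h.sA hsβ), wd_mul _ h.sA hsβ, Matrix.trace_add]
  have h2 : wd (-Complex.I) (wd Complex.I (fB P)) p
      = wd (-Complex.I) (wd Complex.I P) p * fB P p + wd (-Complex.I) P p * wd Complex.I (fB P) p
        - (wd Complex.I (ft P) p • P p + ft P p • wd Complex.I P p) := by
    rw [wd_comm _ _ h.sB, wd_congr _ h.dB, wd_comm (-Complex.I) Complex.I h.smooth,
      ← wd_smul _ h.st h.smooth, ← wd_mul _ (smooth_wd _ h.smooth) h.sB]
    exact wd_sub _ (smooth_mul (smooth_wd _ h.smooth) h.sB) (smooth_smul h.st h.smooth) p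
  have e1 : (fA P p * (wd (-Complex.I) (wd Complex.I P) p * fB P p)).trace
      = -(ft P p * (ft P p + fs P p)) := by
    rw [← h.PB, ← mul_assoc (wd (-Complex.I) (wd Complex.I P) p), h.cP, neg_mul, smul_mul_assoc,
      h.PB, mul_neg, mul_smul_comm, Matrix.trace_neg, Matrix.trace_smul, h.tr_AB, smul_eq_mul]
    ring
  have e2 : (fA P p * (wd (-Complex.I) P p * wd Complex.I (fB P) p)).trace = fs P p * ft P p := by
    rw [← h.AP, mul_assoc, ← mul_assoc (P p), alg_ab _ _ _ _ _ _ (h.proj p) (h.d1 _ p) (h.sand_s p)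
      (h.PB p) (h.dPB Complex.I p), mul_smul_comm, Matrix.trace_smul, h.tr_AB, smul_eq_mul]
  have e3 : (fA P p * (wd Complex.I (ft P) p • P p)).trace = 0 := by
    rw [Matrix.trace_mul_comm, smul_mul_assoc, h.PA, smul_zero, Matrix.trace_zero]
  have e4 : (fA P p * (ft P p • wd Complex.I P p)).trace = ft P p * ft P p := by
    rw [mul_smul_comm, ← h.AP, mul_assoc]
    change (ft P p • (fA P p * fB P p)).trace = _
    rw [Matrix.trace_smul, h.tr_AB, smul_eq_mul]
  rw [h2, mul_sub, mul_add, mul_add, Matrix.trace_sub, Matrix.trace_add, Matrix.trace_add, e1, e2,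
    e3, e4]
  ring

lemma αH (h : Sol P) (p) : (wd Complex.I (fB P) p)ᴴ = wd (-Complex.I) (fA P) p := by
  rw [h.wBH]
  simp

/-- `t tr(EE†) = tr(αβ) - s t - ∂₋t ∂₊t / t` -/
lemma trEE (h : Sol P) (h0 : ∀ p, ft P p ≠ 0) (p) :
    ft P p * (ft P p * (fE P p * (fE P p)ᴴ).trace) =
      ft P p * ((wd (-Complex.I) (fA P) p * wd Complex.I (fB P) p).trace - fs P p * ft P p)
        - wd Complex.I (ft P) p * wd (-Complex.I) (ft P) p := by
  have k1 : ft P p • (fE P p)ᴴ = wd (-Complex.I) (fA P) p * fB P p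
      - star (wd Complex.I (ft P) p) • fQ P p := by
    have := congrArg Matrix.conjTranspose (h.tE h0 p)
    rwa [Matrix.conjTranspose_smul, h.star_t, Matrix.conjTranspose_sub, Matrix.conjTranspose_mul,
      h.αH, h.AH, Matrix.conjTranspose_smul, h.QH] at this
  have k2 : ft P p • (fE P p * (fE P p)ᴴ) = fE P p * (wd (-Complex.I) (fA P) p * fB P p) := by
    rw [← mul_smul_comm, k1, mul_sub, mul_smul_comm, h.EQ h0, smul_zero, sub_zero]
  have k3 : fB P p * (ft P p • fE P p) = ft P p • (P p * wd Complex.I (fB P) p)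
      - wd Complex.I (ft P) p • fB P p := by
    rw [h.tE h0, mul_sub, mul_smul_comm, h.BQ h0, ← mul_assoc, h.BA, smul_mul_assoc]
  have k4 : ft P p * (ft P p * (fE P p * (fE P p)ᴴ).trace)
      = ft P p * (P p * wd Complex.I (fB P) p * wd (-Complex.I) (fA P) p).trace
        - wd Complex.I (ft P) p * (fB P p * wd (-Complex.I) (fA P) p).trace := by
    rw [← smul_eq_mul, ← smul_eq_mul, ← Matrix.trace_smul, ← Matrix.trace_smul, k2,
      ← smul_mul_assoc, ← mul_assoc, Matrix.trace_mul_comm, ← mul_assoc, k3, sub_mul,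
      Matrix.trace_sub, smul_mul_assoc, smul_mul_assoc, Matrix.trace_smul, Matrix.trace_smul]
    simp only [smul_eq_mul]
  have k5 : (fB P p * wd (-Complex.I) (fA P) p).trace = wd (-Complex.I) (ft P) p := by
    have h1 := congrArg Matrix.trace (h.dt (-Complex.I) p)
    have hz : (wd (-Complex.I) P p).trace = 0 := by
      rw [← wd_tr _ h.smooth, wd_congr _ h.tr, wd_zero]
    have hz' : (wd (-Complex.I) (fB P) p * fA P p).trace = 0 := by
      rw [h.dB, sub_mul, smul_mul_assoc, h.PA, smul_zero, sub_zero, h.aB, mul_assoc, h.BA,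
        mul_smul_comm, h.AP, Matrix.trace_smul, ← h.AP, Matrix.trace_mul_comm, h.PA]
      simp
    rw [Matrix.trace_add, hz', zero_add, Matrix.trace_add, Matrix.trace_smul, Matrix.trace_smul,
      h.tr, hz] at h1
    simpa using h1
  have k6 : (P p * wd Complex.I (fB P) p * wd (-Complex.I) (fA P) p).trace
      = (wd (-Complex.I) (fA P) p * wd Complex.I (fB P) p).trace - fs P p * ft P p := by
    have h1 := h.dPB Complex.I p
    have h2 : P p * wd Complex.I (fB P) p = wd Complex.I (fB P) p - wd Complex.I P p * fB P p :=
      eq_sub_of_add_eq' h1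
    rw [h2, Matrix.trace_mul_comm, mul_sub, Matrix.trace_sub]
    congr 1
    have h3 : wd (-Complex.I) (fA P) p * P p + fA P p * wd (-Complex.I) P p
        = wd (-Complex.I) (fA P) p := by
      rw [← wd_mul _ h.sA h.smooth]
      exact wd_congr _ h.AP p
    have h4 : P p * (wd Complex.I P p * fB P p) = 0 := by
      rw [← h.PB, ← mul_assoc, ← mul_assoc, alg_PxP _ _ (h.proj p) (h.d1 (Complex.I) p), zero_mul]
    have h5 : wd (-Complex.I) (fA P) p * (wd Complex.I P p * fB P p)
        = fs P p • (fA P p * fB P p) := by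
      rw [← h3, add_mul, mul_assoc, h4, mul_zero, zero_add, ← h.PB, ← mul_assoc (wd Complex.I P p),
        ← h.AP]
      calc _ = fA P p * (P p * (wd (-Complex.I) P p * wd Complex.I P p) * P p) * fB P p := by
            simp only [mul_assoc]
        _ = _ := by rw [h.sand_s]; simp only [mul_smul_comm, smul_mul_assoc, mul_assoc, h.PB]
    rw [h5, Matrix.trace_smul, h.tr_AB, smul_eq_mul]
  rw [k4, k5, k6]

end Sol
end main

section polar

def cc (r θ : ℝ) : ℝ × ℝ := (r * Real.cos θ, r * Real.sin θ)

/-- angular integral -/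
def ang (F : ℝ × ℝ → ℝ) (r : ℝ) : ℝ := ∫ θ in (-Real.pi)..Real.pi, F (cc r θ)

lemma cont_cc : Continuous (fun z : ℝ × ℝ => cc z.1 z.2) := by
  unfold cc; fun_prop

lemma cont_par (F : ℝ × ℝ → ℝ) (hF : Continuous F) :
    Continuous (fun r => ∫ θ in (-Real.pi)..Real.pi, F (r, θ)) :=
  intervalIntegral.continuous_parametric_intervalIntegral_of_continuous' (f := fun r θ => F (r, θ))
    (by simpa [Function.uncurry_def] using hF) _ _

lemma cont_ang {F : ℝ × ℝ → ℝ} (hF : Continuous F) : Continuous (ang F) :=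
  cont_par (fun z => F (cc z.1 z.2)) (hF.comp cont_cc)

lemma swap_cont (F : ℝ × ℝ → ℝ) (hF : Continuous F) (a b : ℝ) (hab : a ≤ b) :
    ∫ θ in (-Real.pi)..Real.pi, ∫ r in a..b, F (r, θ) =
      ∫ r in a..b, ∫ θ in (-Real.pi)..Real.pi, F (r, θ) := by
  have hpi : -Real.pi ≤ Real.pi := by linarith [Real.pi_pos]
  simp only [intervalIntegral.integral_of_le hab, intervalIntegral.integral_of_le hpi]
  rw [integral_integral_swap]
  have : IntegrableOn (Function.uncurry fun θ r => F (r, θ))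
      (Set.Icc (-Real.pi) Real.pi ×ˢ Set.Icc a b) (volume.prod volume) := by
    apply ContinuousOn.integrableOn_compact (isCompact_Icc.prod isCompact_Icc)
    apply Continuous.continuousOn
    exact hF.comp (continuous_snd.prodMk continuous_fst)
  rw [Measure.prod_restrict]
  exact this.mono_set (Set.prod_mono Set.Ioc_subset_Icc_self Set.Ioc_subset_Icc_self)

lemma polar_lintegral {F : ℝ × ℝ → ℝ} (hF : Continuous F) (h0 : ∀ p, 0 ≤ F p) :
    ∫⁻ p, ENNReal.ofReal (F p) = ∫⁻ r in Set.Ioi (0 : ℝ), ENNReal.ofReal (r * ang F r) := by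
  have hpi : -Real.pi ≤ Real.pi := by linarith [Real.pi_pos]
  rw [← lintegral_comp_polarCoord_symm]
  have ht : polarCoord.target = Set.Ioi (0 : ℝ) ×ˢ Set.Ioo (-Real.pi) Real.pi := rfl
  have hs : ∀ p : ℝ × ℝ, polarCoord.symm p = cc p.1 p.2 := fun p => rfl
  simp only [hs, smul_eq_mul]
  rw [ht, Measure.volume_eq_prod, setLIntegral_prod]
  · refine setLIntegral_congr_fun measurableSet_Ioi fun r hr => ?_
    have hr : 0 < r := hr
    simp only
    rw [lintegral_const_mul' _ _ ENNReal.ofReal_ne_top, ENNReal.ofReal_mul hr.le]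
    congr 1
    have hc : Continuous (fun θ => F (cc r θ)) := hF.comp (cont_cc.comp (by fun_prop : Continuous fun θ : ℝ => (r, θ)))
    rw [ang, intervalIntegral.integral_of_le hpi, integral_Ioc_eq_integral_Ioo,
      ofReal_integral_eq_lintegral_ofReal]
    · exact (hc.continuousOn.integrableOn_compact isCompact_Icc).mono_set Set.Ioo_subset_Icc_self
    · exact Filter.Eventually.of_forall fun _ => h0 _
  · apply Measurable.aemeasurable
    have := (hF.comp cont_cc).measurable
    exact (ENNReal.measurable_ofReal.comp measurable_fst).mul (ENNReal.measurable_ofReal.comp this)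

variable {u : ℝ × ℝ → ℝ}

def ux (u : ℝ × ℝ → ℝ) (p : ℝ × ℝ) : ℝ := fderiv ℝ u p (1, 0)
def uy (u : ℝ × ℝ → ℝ) (p : ℝ × ℝ) : ℝ := fderiv ℝ u p (0, 1)
def lap (u : ℝ × ℝ → ℝ) (p : ℝ × ℝ) : ℝ := ux (ux u) p + uy (uy u) p

lemma sux (hu : ContDiff ℝ (⊤ : ℕ∞) u) : ContDiff ℝ (⊤ : ℕ∞) (ux u) :=
  (hu.fderiv_right (m := (⊤ : ℕ∞)) (by simp)).clm_apply contDiff_const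
lemma suy (hu : ContDiff ℝ (⊤ : ℕ∞) u) : ContDiff ℝ (⊤ : ℕ∞) (uy u) :=
  (hu.fderiv_right (m := (⊤ : ℕ∞)) (by simp)).clm_apply contDiff_const

lemma fd_lin (u : ℝ × ℝ → ℝ) (p : ℝ × ℝ) (a b : ℝ) :
    fderiv ℝ u p (a, b) = a * ux u p + b * uy u p := by
  have : ((a, b) : ℝ × ℝ) = a • (1, 0) + b • (0, 1) := by simp
  rw [this, map_add, map_smul, map_smul]
  rfl

lemma deriv_r (hu : ContDiff ℝ (⊤ : ℕ∞) u) (r θ : ℝ) : HasDerivAt (fun r => u (cc r θ))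
    (Real.cos θ * ux u (cc r θ) + Real.sin θ * uy u (cc r θ)) r := by
  have h1 : HasDerivAt (fun r => cc r θ) (Real.cos θ, Real.sin θ) r := by
    simpa [cc] using ((hasDerivAt_id r).mul_const (Real.cos θ)).prodMk
      ((hasDerivAt_id r).mul_const (Real.sin θ))
  have h2 := (hu.differentiable (by simp) (cc r θ)).hasFDerivAt.comp_hasDerivAt r h1
  rw [fd_lin] at h2
  exact h2

lemma deriv_θ (hu : ContDiff ℝ (⊤ : ℕ∞) u) (r θ : ℝ) : HasDerivAt (fun θ => u (cc r θ))
    (-(r * Real.sin θ) * ux u (cc r θ) + r * Real.cos θ * uy u (cc r θ)) θ := by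
  have h1 : HasDerivAt (fun θ => cc r θ) (-(r * Real.sin θ), r * Real.cos θ) θ := by
    simpa [cc] using ((Real.hasDerivAt_cos θ).const_mul r).prodMk
      ((Real.hasDerivAt_sin θ).const_mul r)
  have h2 := (hu.differentiable (by simp) (cc r θ)).hasFDerivAt.comp_hasDerivAt θ h1
  rw [fd_lin] at h2
  exact h2

/-- radial derivative -/
def fD (u : ℝ × ℝ → ℝ) (z : ℝ × ℝ) : ℝ :=
  Real.cos z.2 * ux u (cc z.1 z.2) + Real.sin z.2 * uy u (cc z.1 z.2)

def fw (u : ℝ × ℝ → ℝ) (r θ : ℝ) : ℝ :=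
  -Real.sin θ * ux u (cc r θ) + Real.cos θ * uy u (cc r θ)

def fV (u : ℝ × ℝ → ℝ) (z : ℝ × ℝ) : ℝ := fD u z + z.1 * (Real.cos z.2 * fD (ux u) z
    + Real.sin z.2 * fD (uy u) z)

def fw' (u : ℝ × ℝ → ℝ) (z : ℝ × ℝ) : ℝ := z.1 * lap u (cc z.1 z.2) - fV u z

lemma cont_D (hu : ContDiff ℝ (⊤ : ℕ∞) u) : Continuous (fD u) := by
  have h1 := (sux hu).continuous.comp cont_cc
  have h2 := (suy hu).continuous.comp cont_cc
  exact ((Real.continuous_cos.comp continuous_snd).mul h1).add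
    ((Real.continuous_sin.comp continuous_snd).mul h2)

lemma cont_lap (hu : ContDiff ℝ (⊤ : ℕ∞) u) : Continuous (lap u) :=
  (sux (sux hu)).continuous.add (suy (suy hu)).continuous

lemma cont_V (hu : ContDiff ℝ (⊤ : ℕ∞) u) : Continuous (fV u) :=
  (cont_D hu).add (continuous_fst.mul
    (((Real.continuous_cos.comp continuous_snd).mul (cont_D (sux hu))).add
    ((Real.continuous_sin.comp continuous_snd).mul (cont_D (suy hu)))))

lemma cont_w' (hu : ContDiff ℝ (⊤ : ℕ∞) u) : Continuous (fw' u) :=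
  (continuous_fst.mul ((cont_lap hu).comp cont_cc)).sub (cont_V hu)

lemma deriv_V (hu : ContDiff ℝ (⊤ : ℕ∞) u) (r θ : ℝ) :
    HasDerivAt (fun r => r * fD u (r, θ)) (fV u (r, θ)) r := by
  have h1 := (deriv_r (sux hu) r θ).const_mul (Real.cos θ)
  have h2 := (deriv_r (suy hu) r θ).const_mul (Real.sin θ)
  have h := (hasDerivAt_id r).mul (h1.add h2)
  refine h.congr_deriv ?_
  simp only [fV, fD, id, Pi.add_apply]
  ring

lemma deriv_w (hu : ContDiff ℝ (⊤ : ℕ∞) u) (r θ : ℝ) :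
    HasDerivAt (fun θ => fw u r θ) (fw' u (r, θ)) θ := by
  have h1 := (Real.hasDerivAt_sin θ).neg.mul (deriv_θ (sux hu) r θ)
  have h2 := (Real.hasDerivAt_cos θ).mul (deriv_θ (suy hu) r θ)
  refine (h1.add h2).congr_deriv ?_
  simp only [fw', fV, fD, lap, Pi.neg_apply]
  linear_combination (r * (ux (ux u) (cc r θ) + uy (uy u) (cc r θ))) * Real.sin_sq_add_cos_sq θ

lemma flux (hu : ContDiff ℝ (⊤ : ℕ∞) u) (R : ℝ) (hR : 0 ≤ R) :
    R * (∫ θ in (-Real.pi)..Real.pi, fD u (R, θ)) = ∫ r in (0 : ℝ)..R, r * ang (lap u) r := by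
  have cs : ∀ {G : ℝ × ℝ → ℝ} (hG : Continuous G) (θ : ℝ), Continuous (fun r => G (r, θ)) :=
    fun hG θ => hG.comp (by fun_prop)
  have cs' : ∀ {G : ℝ × ℝ → ℝ} (hG : Continuous G) (r : ℝ), Continuous (fun θ => G (r, θ)) :=
    fun hG θ => hG.comp (by fun_prop)
  have h1 : ∀ θ, R * fD u (R, θ) = ∫ r in (0 : ℝ)..R, fV u (r, θ) := by
    intro θ
    rw [intervalIntegral.integral_eq_sub_of_hasDerivAt (fun r _ => deriv_V hu r θ)
      ((cs (cont_V hu) θ).intervalIntegrable _ _)]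
    simp
  have h2 : ∀ r, ∫ θ in (-Real.pi)..Real.pi, fV u (r, θ) = r * ang (lap u) r := by
    intro r
    have e : ∫ θ in (-Real.pi)..Real.pi, fw' u (r, θ) = 0 := by
      rw [intervalIntegral.integral_eq_sub_of_hasDerivAt (fun θ _ => deriv_w hu r θ)
        ((cs' (cont_w' hu) r).intervalIntegrable _ _)]
      simp [fw, cc]
    have hl : Continuous fun z : ℝ × ℝ => z.1 * lap u (cc z.1 z.2) :=
      continuous_fst.mul ((cont_lap hu).comp cont_cc)
    have e2 := intervalIntegral.integral_sub ((cs' hl r).intervalIntegrable (μ := volume) (-Real.pi) Real.pi)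
      ((cs' (cont_V hu) r).intervalIntegrable (-Real.pi) Real.pi)
    simp only [fw'] at e
    rw [e, intervalIntegral.integral_const_mul] at e2
    rw [ang]
    linarith
  rw [← intervalIntegral.integral_const_mul]
  simp only [h1]
  rw [swap_cont _ (cont_V hu) _ _ hR]
  simp only [h2]

lemma mean_mono (hu : ContDiff ℝ (⊤ : ℕ∞) u) (a b : ℝ) (hab : a ≤ b)
    (h : ∀ r, a ≤ r → 0 ≤ ∫ θ in (-Real.pi)..Real.pi, fD u (r, θ)) : ang u a ≤ ang u b := by
  have hc : ∀ r, Continuous fun θ => u (cc r θ) := fun r =>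
    hu.continuous.comp (cont_cc.comp (by fun_prop : Continuous fun θ : ℝ => (r, θ)))
  have h1 : ang u b - ang u a = ∫ r in a..b, ∫ θ in (-Real.pi)..Real.pi, fD u (r, θ) := by
    rw [← swap_cont _ (cont_D hu) _ _ hab, ang, ang, ← intervalIntegral.integral_sub
      ((hc b).intervalIntegrable _ _) ((hc a).intervalIntegrable _ _)]
    congr 1
    funext θ
    exact (intervalIntegral.integral_eq_sub_of_hasDerivAt (f' := fun r => fD u (r, θ))
      (fun r _ => deriv_r hu r θ)
      (((cont_D hu).comp
        (by fun_prop : Continuous fun r : ℝ => (r, θ))).intervalIntegrable _ _)).symm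
  have h2 : 0 ≤ ∫ r in a..b, ∫ θ in (-Real.pi)..Real.pi, fD u (r, θ) :=
    intervalIntegral.integral_nonneg hab fun r hr => h r hr.1
  linarith

lemma jensen (hu : Continuous u) (r m : ℝ) (hm : 2 * Real.pi * m ≤ ang u r) :
    2 * Real.pi * Real.exp m ≤ ang (fun p => Real.exp (u p)) r := by
  have hpi : -Real.pi ≤ Real.pi := by linarith [Real.pi_pos]
  have hc : Continuous fun θ => u (cc r θ) :=
    hu.comp (cont_cc.comp (by fun_prop : Continuous fun θ : ℝ => (r, θ)))
  have h1 : ∫ θ in (-Real.pi)..Real.pi, Real.exp m * (u (cc r θ) + (1 - m))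
      ≤ ang (fun p => Real.exp (u p)) r := by
    apply intervalIntegral.integral_mono_on hpi
    · exact (continuous_const.mul (hc.add continuous_const)).intervalIntegrable _ _
    · exact (Real.continuous_exp.comp hc).intervalIntegrable _ _
    · intro θ _
      have := Real.add_one_le_exp (u (cc r θ) - m)
      calc Real.exp m * (u (cc r θ) + (1 - m)) ≤ Real.exp m * Real.exp (u (cc r θ) - m) := by
            gcongr; linarith
        _ = _ := by rw [← Real.exp_add]; congr 1; ring
  rw [intervalIntegral.integral_const_mul, intervalIntegral.integral_add
    (hc.intervalIntegrable _ _) (by simp), intervalIntegral.integral_const] at h1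
  change Real.exp m * (ang u r + _) ≤ _ at h1
  refine le_trans ?_ h1
  have : 2 * Real.pi ≤ ang u r + (Real.pi - -Real.pi) • (1 - m) := by
    simp only [smul_eq_mul]; linarith
  calc 2 * Real.pi * Real.exp m = Real.exp m * (2 * Real.pi) := by ring
    _ ≤ _ := by gcongr

theorem integrable_of_lap (hu : ContDiff ℝ (⊤ : ℕ∞) u) (f g : ℝ × ℝ → ℝ) (hf : Continuous f)
    (hg : Continuous g) (hf0 : ∀ p, 0 ≤ f p) (hgi : Integrable g)
    (hexp : Integrable (fun p => Real.exp (u p))) (hl : ∀ p, lap u p = f p - g p) :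
    Integrable f := by
  have hpi : -Real.pi ≤ Real.pi := by linarith [Real.pi_pos]
  have hnn : ∀ {F : ℝ × ℝ → ℝ}, (∀ p, 0 ≤ F p) → ∀ r, 0 ≤ ang F r := fun h r =>
    intervalIntegral.integral_nonneg hpi fun θ _ => h _
  have hcr : ∀ {F : ℝ × ℝ → ℝ}, Continuous F → Continuous (fun r => r * ang F r) :=
    fun h => continuous_id.mul (cont_ang h)
  have hfin : ∀ {F : ℝ × ℝ → ℝ}, Continuous F → (∀ p, 0 ≤ F p) → Integrable F →
      IntegrableOn (fun r => r * ang F r) (Set.Ioi 0) := by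
    intro F hF h0 hi
    refine ⟨(hcr hF).aestronglyMeasurable, ?_⟩
    rw [hasFiniteIntegral_iff_ofReal]
    · rw [← polar_lintegral hF h0]
      exact (hasFiniteIntegral_iff_ofReal (Filter.Eventually.of_forall h0)).1 hi.2
    · filter_upwards [ae_restrict_mem measurableSet_Ioi] with r hr
      exact mul_nonneg (le_of_lt hr) (hnn h0 r)
  have hga := hfin hg.abs (fun p => abs_nonneg (g p)) hgi.abs
  set C := ∫ r in Set.Ioi (0 : ℝ), r * ang (fun p => |g p|) r with hC
  have hgle : ∀ R, 0 ≤ R → ∫ r in (0 : ℝ)..R, r * ang g r ≤ C := by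
    intro R hR
    calc ∫ r in (0 : ℝ)..R, r * ang g r ≤ ∫ r in (0 : ℝ)..R, r * ang (fun p => |g p|) r := by
          apply intervalIntegral.integral_mono_on hR
          · exact (hcr hg).intervalIntegrable _ _
          · exact (hcr hg.abs).intervalIntegrable _ _
          · intro r hr
            apply mul_le_mul_of_nonneg_left _ hr.1
            have hcs : ∀ {F : ℝ × ℝ → ℝ}, Continuous F → Continuous fun θ => F (cc r θ) := fun h =>
              h.comp (cont_cc.comp (by fun_prop : Continuous fun θ : ℝ => (r, θ)))
            apply intervalIntegral.integral_mono_on hpi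
            · exact (hcs hg).intervalIntegrable _ _
            · exact (hcs hg.abs).intervalIntegrable _ _
            · exact fun θ _ => le_abs_self _
      _ ≤ C := by
          rw [intervalIntegral.integral_of_le hR]
          apply setIntegral_mono_set hga
          · filter_upwards [ae_restrict_mem measurableSet_Ioi] with r hr
            exact mul_nonneg (le_of_lt hr) (hnn (fun p => abs_nonneg (g p)) r)
          · exact Filter.Eventually.of_forall fun r hr => hr.1
  have hangl : ∀ r, r * ang (lap u) r = r * ang f r - r * ang g r := by
    intro r
    have hcs : ∀ {F : ℝ × ℝ → ℝ}, Continuous F → Continuous fun θ => F (cc r θ) := fun h =>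
      h.comp (cont_cc.comp (by fun_prop : Continuous fun θ : ℝ => (r, θ)))
    rw [← mul_sub]
    congr 1
    simp only [ang, hl]
    exact intervalIntegral.integral_sub ((hcs hf).intervalIntegrable _ _)
      ((hcs hg).intervalIntegrable _ _)
  have hfle : ∀ R, 0 < R → ∫ r in (0 : ℝ)..R, r * ang f r ≤ C := by
    intro R hR
    by_contra! hcon
    have hD : ∀ r, R ≤ r → 0 ≤ ∫ θ in (-Real.pi)..Real.pi, fD u (r, θ) := by
      intro r hr
      have hr0 : 0 < r := lt_of_lt_of_le hR hr
      have h1 := flux hu r hr0.le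
      simp only [hangl] at h1
      rw [intervalIntegral.integral_sub ((hcr hf).intervalIntegrable _ _)
        ((hcr hg).intervalIntegrable _ _)] at h1
      have h2 : ∫ r in (0 : ℝ)..R, r * ang f r ≤ ∫ r in (0 : ℝ)..r, r * ang f r := by
        rw [← intervalIntegral.integral_add_adjacent_intervals
          ((hcr hf).intervalIntegrable 0 R) ((hcr hf).intervalIntegrable R r)]
        have : 0 ≤ ∫ r in R..r, r * ang f r := intervalIntegral.integral_nonneg hr fun x hx =>
          mul_nonneg (hR.le.trans hx.1) (hnn hf0 x)
        linarith
      have h3 := hgle r hr0.le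
      have : 0 ≤ r * ∫ θ in (-Real.pi)..Real.pi, fD u (r, θ) := by linarith
      exact nonneg_of_mul_nonneg_right this hr0
    set m := ang u R / (2 * Real.pi) with hm
    have hlow : ∀ r, R ≤ r → 2 * Real.pi * Real.exp m ≤ ang (fun p => Real.exp (u p)) r := by
      intro r hr
      apply jensen hu.continuous
      have := mean_mono hu R r hr hD
      have hp := Real.pi_pos
      rw [hm]
      field_simp
      linarith
    have hce : Continuous fun p => Real.exp (u p) := Real.continuous_exp.comp hu.continuous
    have hei := (hfin hce (fun p => (Real.exp_pos _).le) hexp).mono_set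
      (Set.Ioi_subset_Ioi hR.le)
    have hconst : IntegrableOn (fun _ : ℝ => R * (2 * Real.pi * Real.exp m)) (Set.Ioi R) := by
      refine Integrable.mono' hei aestronglyMeasurable_const ?_
      filter_upwards [ae_restrict_mem measurableSet_Ioi] with r hr
      have hr : R < r := hr
      have hp := Real.pi_pos
      rw [Real.norm_of_nonneg (by positivity)]
      have := hlow r hr.le
      exact mul_le_mul hr.le this (by positivity) (hR.le.trans hr.le)
    rw [integrableOn_const_iff] at hconst
    have hp := Real.pi_pos
    rcases hconst with h | h
    · have : R * (2 * Real.pi * Real.exp m) ≠ 0 := by positivity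
      exact this (by simpa using h)
    · simp at h
  have hfi : IntegrableOn (fun r => r * ang f r) (Set.Ioi 0) := by
    refine integrableOn_Ioi_of_intervalIntegral_norm_bounded C 0 (b := fun R : ℝ => R)
      (l := Filter.atTop) (fun R => ?_) Filter.tendsto_id ?_
    · exact ((hcr hf).continuousOn.integrableOn_compact isCompact_Icc).mono_set
        Set.Ioc_subset_Icc_self
    · filter_upwards [Filter.eventually_gt_atTop (0 : ℝ)] with R hR
      refine le_trans (le_of_eq ?_) (hfle R hR)
      apply intervalIntegral.integral_congr
      intro r hr
      rw [Set.uIcc_of_le hR.le] at hr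
      exact Real.norm_of_nonneg (mul_nonneg hr.1 (hnn hf0 r))
  refine ⟨hf.aestronglyMeasurable, ?_⟩
  rw [hasFiniteIntegral_iff_ofReal (Filter.Eventually.of_forall hf0), polar_lintegral hf hf0]
  refine (hasFiniteIntegral_iff_ofReal ?_).1 hfi.2
  filter_upwards [ae_restrict_mem measurableSet_Ioi] with r hr
  exact mul_nonneg (le_of_lt hr) (hnn hf0 r)

end polar


section final

lemma wd_ofReal (ε : ℂ) {v : ℝ × ℝ → ℝ} (hv : ContDiff ℝ (⊤ : ℕ∞) v) (p : ℝ × ℝ) :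
    wd ε (fun q => (v q : ℂ)) p = 2⁻¹ * ((ux v p : ℂ) + ε * (uy v p : ℂ)) := by
  have h := (Complex.ofRealCLM.hasFDerivAt.comp p
    (hv.differentiable (by simp) p).hasFDerivAt).fderiv
  change fderiv ℝ (fun q => (v q : ℂ)) p = _ at h
  simp [wd, h, ux, uy]

lemma wd_exp (ε : ℂ) {v : ℝ × ℝ → ℝ} (hv : ContDiff ℝ (⊤ : ℕ∞) v) (p : ℝ × ℝ) :
    wd ε (fun q => ((Real.exp (v q) : ℝ) : ℂ)) p
      = ((Real.exp (v p) : ℝ) : ℂ) * wd ε (fun q => (v q : ℂ)) p := by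
  rw [wd_ofReal ε hv, wd_ofReal ε (v := fun q => Real.exp (v q)) (Real.contDiff_exp.comp hv)]
  have h := (hv.differentiable (by simp) p).hasFDerivAt.exp.fderiv
  simp only [ux, uy, h, _root_.smul_apply, smul_eq_mul]
  push_cast
  ring

lemma smooth_ofReal {v : ℝ × ℝ → ℝ} (hv : ContDiff ℝ (⊤ : ℕ∞) v) :
    ContDiff ℝ (⊤ : ℕ∞) (fun q => (v q : ℂ)) := Complex.ofRealCLM.contDiff.comp hv

lemma wd_lap {v : ℝ × ℝ → ℝ} (hv : ContDiff ℝ (⊤ : ℕ∞) v) (p : ℝ × ℝ) :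
    (wd (-Complex.I) (wd Complex.I (fun q => (v q : ℂ))) p).re = lap v p / 4 := by
  have h1 : ∀ q, wd Complex.I (fun q => (v q : ℂ)) q
      = 2⁻¹ * (ux v q : ℂ) - (-(Complex.I / 2)) * (uy v q : ℂ) := by
    intro q
    rw [wd_ofReal _ hv]; ring
  have sx := smooth_ofReal (sux hv)
  have sy := smooth_ofReal (suy hv)
  rw [wd_congr _ h1, wd_sub' _ (contDiff_const.mul sx) (contDiff_const.mul sy),
    wd_cmul _ contDiff_const sx, wd_cmul _ contDiff_const sy, wd_zero, wd_zero,
    wd_ofReal _ (sux hv), wd_ofReal _ (suy hv)]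
  simp [lap]
  ring

lemma tr_pos {N : ℕ} (X : Matrix (Fin N) (Fin N) ℂ) :
    0 ≤ (X * Xᴴ).trace.re ∧ (X * Xᴴ).trace.im = 0 := by
  open ComplexOrder in
  have h := (Matrix.posSemidef_self_mul_conjTranspose X).trace_nonneg
  rw [Complex.le_def] at h
  exact ⟨h.1, h.2.symm⟩

variable {N : ℕ} {P : ℝ × ℝ → Matrix (Fin N) (Fin N) ℂ}

theorem Sol.integrable (h : Sol P) (h0 : ∀ p, ft P p ≠ 0)
    (hi : Integrable (fun p => (wd (-Complex.I) P p * wd Complex.I P p).trace)) :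
    Integrable (fun p => (wd (-Complex.I) (fQ P) p * wd Complex.I (fQ P) p).trace) := by
  have ht : ∀ p, 0 ≤ (ft P p).re ∧ (ft P p).im = 0 := by
    intro p
    have := tr_pos (fA P p)
    rwa [h.AH, h.tr_AB] at this
  have htp : ∀ p, 0 < (ft P p).re := by
    intro p
    refine lt_of_le_of_ne (ht p).1 fun e => h0 p ?_
    exact Complex.ext e.symm (ht p).2
  have hs : ∀ p, 0 ≤ (fs P p).re ∧ (fs P p).im = 0 := by
    intro p
    have := tr_pos (P p * wd (-Complex.I) P p)
    have e : (P p * wd (-Complex.I) P p * (P p * wd (-Complex.I) P p)ᴴ).trace = fs P p := by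
      rw [Matrix.conjTranspose_mul, h.herm, h.ctp, ← Matrix.mul_assoc, Matrix.trace_mul_comm,
        Matrix.mul_assoc, ← Matrix.mul_assoc, ← Matrix.mul_assoc, h.proj, fs, Matrix.mul_assoc]
    rwa [e] at this
  have hE := fun p => tr_pos (fE P p)
  have sre : ContDiff ℝ (⊤ : ℕ∞) (fun p => (ft P p).re) := Complex.reCLM.contDiff.comp h.st
  set u : ℝ × ℝ → ℝ := fun p => Real.log (ft P p).re with hu
  have su : ContDiff ℝ (⊤ : ℕ∞) u := sre.log fun p => (htp p).ne'
  have hexp : ∀ p, Real.exp (u p) = (ft P p).re := fun p => Real.exp_log (htp p)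
  have hft : ∀ p, ft P p = ((Real.exp (u p) : ℝ) : ℂ) := by
    intro p
    rw [hexp]
    exact Complex.ext (by simp) (by simp [(ht p).2])
  set U : ℝ × ℝ → ℂ := fun p => (u p : ℂ) with hU
  have sU : ContDiff ℝ (⊤ : ℕ∞) U := smooth_ofReal su
  have hd : ∀ ε p, wd ε (ft P) p = ft P p * wd ε U p := by
    intro ε p
    rw [wd_congr ε hft, wd_exp ε su, ← hft]
  have hdd : ∀ p, wd (-Complex.I) (wd Complex.I (ft P)) p =
      ft P p * wd (-Complex.I) U p * wd Complex.I U p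
        + ft P p * wd (-Complex.I) (wd Complex.I U) p := by
    intro p
    rw [wd_congr _ (hd Complex.I), wd_cmul _ h.st (smooth_wd _ sU), hd]
  have key : ∀ p, wd (-Complex.I) (wd Complex.I U) p =
      (fE P p * (fE P p)ᴴ).trace + fs P p - 2 * ft P p := by
    intro p
    have h1 := h.trEE h0 p
    have h2 := h.ddt p
    rw [hdd] at h2
    rw [hd, hd] at h1
    have h3 : ft P p * ft P p ≠ 0 := mul_ne_zero (h0 p) (h0 p)
    apply mul_left_cancel₀ h3
    linear_combination ft P p * h2 - h1
  have hlap : ∀ p, lap u p = 4 * (wd (-Complex.I) (fQ P) p * wd Complex.I (fQ P) p).trace.re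
      - (16 * (ft P p).re
        - 4 * (wd (-Complex.I) P p * wd Complex.I P p).trace.re) := by
    intro p
    have h1 := wd_lap su p
    have h2 := congrArg Complex.re (key p)
    rw [h1] at h2
    rw [h.LQ h0, h.LP]
    simp at h2 ⊢
    linarith
  have cre : ∀ {F : ℝ × ℝ → ℂ}, ContDiff ℝ (⊤ : ℕ∞) F → Continuous fun p => (F p).re :=
    fun hF => Complex.continuous_re.comp hF.continuous
  have cP := cre (smooth_tr (smooth_mul (smooth_wd (-Complex.I) h.smooth)
    (smooth_wd Complex.I h.smooth)))
  have cQ := cre (smooth_tr (smooth_mul (smooth_wd (-Complex.I) (h.sQ h0))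
    (smooth_wd Complex.I (h.sQ h0))))
  have hire : Integrable fun p => (wd (-Complex.I) P p * wd Complex.I P p).trace.re := hi.re
  have hti : Integrable fun p => (ft P p).re := by
    refine hire.mono' (cre h.st).aestronglyMeasurable (Filter.Eventually.of_forall fun p => ?_)
    rw [Real.norm_of_nonneg (ht p).1, h.LP, Complex.add_re]
    linarith [(hs p).1]
  have hnn : ∀ p, 0 ≤ (wd (-Complex.I) (fQ P) p * wd Complex.I (fQ P) p).trace.re := by
    intro p
    rw [h.LQ h0, Complex.add_re]
    linarith [(hE p).1, (ht p).1]
  have main := integrable_of_lap su _ _ (continuous_const.mul cQ)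
    ((continuous_const.mul (cre h.st)).sub (continuous_const.mul cP))
    (fun p => mul_nonneg (by norm_num) (hnn p))
    ((hti.const_mul 16).sub (hire.const_mul 4))
    (by simpa only [hexp] using hti) hlap
  have main2 := (main.const_mul (1 / 4)).ofReal (𝕜 := ℂ)
  refine main2.congr (Filter.Eventually.of_forall fun p => ?_)
  apply Complex.ext
  · simp
  · simp [h.LQ h0, (hE p).2, (ht p).2]

end final



/-- If `P` is a smooth rank-one Hermitian projector solution of the Euler–Lagrange equation
with finite action, and `t = trace(∂₊P·P·∂₋P)` is nowhere zero, then
`Π₊P = (∂₊P·P·∂₋P)/t` is again a smooth rank-one Hermitian projector solution of the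
Euler–Lagrange equation with finite action. -/
theorem raising_operator_maps_solutions {N : ℕ} (P : ℝ × ℝ → Matrix (Fin N) (Fin N) ℂ)
    (hP : ContDiff ℝ (⊤ : ℕ∞) P)
    (hproj : ∀ p, P p * P p = P p)
    (hherm : ∀ p, (P p)ᴴ = P p)
    (htr : ∀ p, (P p).trace = 1)
    (hEL : ∀ p, dp (fun q => dm P q) p * P p - P p * dp (fun q => dm P q) p = 0)
    (haction : Integrable (fun p => (dp P p * dm P p).trace) (volume : Measure (ℝ × ℝ)))
    (ht0 : ∀ p, (dp P p * P p * dm P p).trace ≠ 0)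
    (PiP : ℝ × ℝ → Matrix (Fin N) (Fin N) ℂ)
    (hPiP : PiP = fun p => ((dp P p * P p * dm P p).trace)⁻¹ • (dp P p * P p * dm P p)) :
    ContDiff ℝ (⊤ : ℕ∞) PiP
    ∧ (∀ p, PiP p * PiP p = PiP p)
    ∧ (∀ p, (PiP p)ᴴ = PiP p)
    ∧ (∀ p, (PiP p).trace = 1)
    ∧ (∀ p, dp (fun q => dm PiP q) p * PiP p - PiP p * dp (fun q => dm PiP q) p = 0)
    ∧ Integrable (fun p => (dp PiP p * dm PiP p).trace) (volume : Measure (ℝ × ℝ)) := by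

  have h : Sol P := ⟨hP, hproj, hherm, htr, fun p => by
    have := sub_eq_zero.1 (hEL p)
    rw [dp_eq_wd] at this
    exact this⟩
  simp only [dp_eq_wd, dm_eq_wd] at ht0 hPiP haction
  have h0 : ∀ p, ft P p ≠ 0 := ht0
  have hQ : PiP = fQ P := by
    rw [hPiP]
    funext p
    rw [fQ, h.ft_AB, ft]
  subst hQ
  refine ⟨h.sQ h0, h.QQ h0, h.QH, h.trQ h0, fun p => ?_, ?_⟩
  · rw [dp_eq_wd]
    exact sub_eq_zero.2 (h.ELQ h0 p)
  · simp only [dp_eq_wd, dm_eq_wd]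
    exact h.integrable h0 haction
end
end
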